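/- arXiv:2310.20522 — 4 statements merged into one kernel-verified Lean document; each statement's English description precedes it below -/
import Mathlib

section
/- Let 𝒳 be a monotone class of graphs that is small, i.e., there is a constant c > 0 with |𝒳ₙ| ≤ n!·cⁿ for all n. Then 𝒳 has bounded degeneracy: there exists a constant d such that every graph in 𝒳 is d-degenerate (every subgraph of every graph in 𝒳 has a vertex of degree at most d). -/
open Real

/-- A graph class: for each `n`, the set of its member graphs with vertex set `Fin n`. -/
abbrev GraphClass := (n : ℕ) → Set (SimpleGraph (Fin n))

/-- `H` is (isomorphic to) a subgraph of `G`: there is an injective map of the vertices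
of `H` into the vertices of `G` sending edges to edges. -/
def IsSubgraphOf {m n : ℕ} (H : SimpleGraph (Fin m)) (G : SimpleGraph (Fin n)) : Prop :=
  ∃ f : Fin m ↪ Fin n, ∀ u v : Fin m, H.Adj u v → G.Adj (f u) (f v)

/-- A graph class is monotone if it is closed under taking subgraphs. -/
def MonotoneGraphClass (𝒳 : GraphClass) : Prop :=
  ∀ {m n : ℕ} (H : SimpleGraph (Fin m)) (G : SimpleGraph (Fin n)),
    G ∈ 𝒳 n → IsSubgraphOf H G → H ∈ 𝒳 m

/-- A graph is `d`-degenerate if every subgraph has a vertex of degree at most `d`;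
equivalently, every nonempty set `A` of vertices contains a vertex having
at most `d` neighbours inside `A`. -/
def Degenerate {n : ℕ} (d : ℕ) (G : SimpleGraph (Fin n)) : Prop :=
  ∀ A : Finset (Fin n), A.Nonempty →
    ∃ v ∈ A, ((A : Set (Fin n)) ∩ G.neighborSet v).ncard ≤ d


/-- Encoding bound for tree homomorphisms. -/
lemma perm_code_bound {m : ℕ} (G : SimpleGraph (Fin m)) [DecidableRel G.Adj]
    (p : Fin m → Fin m) (s : Fin m → Bool)
    (hp : ∀ i : Fin m, i.val ≠ 0 → p i < i)
    (hinj : ∀ i j : Fin m, i.val ≠ 0 → j.val ≠ 0 → p i = p j → s i = s j → i = j)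
    (r : Fin m) (hr : r.val = 0) (B : Finset (Equiv.Perm (Fin m)))
    (hB : ∀ τ ∈ B, ∀ i : Fin m, i.val ≠ 0 → G.Adj (τ i) (τ (p i))) :
    B.card ≤ m * ∏ u : Fin m, (G.degree u + 1) ^ 2 := by
  classical
  let code : Equiv.Perm (Fin m) → Fin m × (Fin m × Bool → Fin m) := fun τ =>
    (τ r, fun x => if h : ∃ i : Fin m, i.val ≠ 0 ∧ p i = τ.symm x.1 ∧ s i = x.2
      then τ h.choose else x.1)
  have hcode : ∀ (τ : Equiv.Perm (Fin m)) (i : Fin m), i.val ≠ 0 →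
      (code τ).2 (τ (p i), s i) = τ i := by
    intro τ i hi
    have h : ∃ j : Fin m, j.val ≠ 0 ∧ p j = τ.symm (τ (p i)) ∧ s j = s i :=
      ⟨i, hi, by simp, rfl⟩
    have h2 := h.choose_spec
    simp only [code]
    rw [dif_pos h]
    congr 1
    apply hinj _ _ h2.1 hi _ h2.2.2
    simpa using h2.2.1
  let C : Finset (Fin m × (Fin m × Bool → Fin m)) :=
    Finset.univ ×ˢ Fintype.piFinset (fun x : Fin m × Bool => insert x.1 (G.neighborFinset x.1))
  have hC : C.card ≤ m * ∏ u : Fin m, (G.degree u + 1) ^ 2 := by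
    simp only [C, Finset.card_product, Finset.card_univ, Fintype.card_fin, Fintype.card_piFinset]
    apply Nat.mul_le_mul_left
    rw [Fintype.prod_prod_type]
    apply Finset.prod_le_prod' 
    intro u _
    simp [pow_two]
  refine le_trans (Finset.card_le_card_of_injOn code ?_ ?_) hC
  · intro τ hτ
    simp only [C, Finset.coe_product, Set.mem_prod, Finset.mem_coe, Finset.mem_univ, true_and,
      Fintype.mem_piFinset, code]
    intro x
    split_ifs with h
    · have h2 := h.choose_spec
      have := hB τ hτ _ h2.1
      rw [h2.2.1] at this
      simp only [Equiv.apply_symm_apply] at this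
      simp [this.symm]
    · simp
  · intro τ _ τ' _ heq
    have key : ∀ k : ℕ, ∀ i : Fin m, i.val = k → τ i = τ' i := by
      intro k
      induction k using Nat.strong_induction_on with
      | _ k ih =>
        intro i hik
        by_cases hi : i.val = 0
        · have : i = r := Fin.ext (by omega)
          rw [this]
          exact congrArg Prod.fst heq
        · have h1 := ih (p i).val (by have := hp i hi; omega) (p i) rfl
          rw [← hcode τ i hi, ← hcode τ' i hi, heq, h1]
    exact Equiv.ext fun i => key _ i rfl

lemma counting {m : ℕ} (G : SimpleGraph (Fin m)) [DecidableRel G.Adj]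
    (p : Fin m → Fin m) (s : Fin m → Bool)
    (hp : ∀ i : Fin m, i.val ≠ 0 → p i < i)
    (hadj : ∀ i : Fin m, i.val ≠ 0 → G.Adj i (p i))
    (hinj : ∀ i j : Fin m, i.val ≠ 0 → j.val ≠ 0 → p i = p j → s i = s j → i = j)
    (r : Fin m) (hr : r.val = 0) (X : Set (SimpleGraph (Fin m)))
    (hX : ∀ (H : SimpleGraph (Fin m)) (σ : Equiv.Perm (Fin m)), H ≤ G → H.comap σ ∈ X) :
    m.factorial * 2 ^ G.edgeFinset.card ≤
      (m * ∏ u : Fin m, (G.degree u + 1) ^ 2) * X.ncard * 2 ^ m := by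
  classical
  let TE : Finset (Sym2 (Fin m)) :=
    (Finset.univ.filter (fun i : Fin m => i.val ≠ 0)).image (fun i => s(i, p i))
  have hTEcard : TE.card ≤ m :=
    Finset.card_image_le.trans ((Finset.card_filter_le _ _).trans (by simp))
  have hTE : TE ⊆ G.edgeFinset := by
    intro e he
    simp only [TE, Finset.mem_image, Finset.mem_filter, Finset.mem_univ, true_and] at he
    obtain ⟨i, hi, rfl⟩ := he
    simpa using hadj i hi
  let H : Finset (Sym2 (Fin m)) → SimpleGraph (Fin m) := fun P =>
    SimpleGraph.fromEdgeSet ((P ∪ TE : Finset (Sym2 (Fin m))) : Set (Sym2 (Fin m)))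
  have hHle : ∀ P ⊆ G.edgeFinset, H P ≤ G := by
    intro P hP a b hab
    simp only [H, SimpleGraph.fromEdgeSet_adj, Finset.mem_coe] at hab
    have := Finset.union_subset hP hTE hab.1
    simpa using this
  have hHT : ∀ P, ∀ i : Fin m, i.val ≠ 0 → (H P).Adj i (p i) := by
    intro P i hi
    simp only [H, SimpleGraph.fromEdgeSet_adj, Finset.mem_coe]
    refine ⟨Finset.mem_union_right _ ?_, (hadj i hi).ne⟩
    simp only [TE, Finset.mem_image, Finset.mem_filter, Finset.mem_univ, true_and]
    exact ⟨i, hi, rfl⟩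
  have hHinj : ∀ P ⊆ G.edgeFinset \ TE, ∀ P' ⊆ G.edgeFinset \ TE, H P = H P' → P ⊆ P' := by
    intro P hP P' hP' h e he
    have he2 := hP he
    simp only [Finset.mem_sdiff] at he2
    induction e using Sym2.ind with
    | _ a b =>
      have hG : G.Adj a b := by simpa using he2.1
      have h1 : (H P).Adj a b := by
        simp only [H, SimpleGraph.fromEdgeSet_adj, Finset.mem_coe]
        exact ⟨Finset.mem_union_left _ he, hG.ne⟩
      rw [h] at h1
      simp only [H, SimpleGraph.fromEdgeSet_adj, Finset.mem_coe, Finset.mem_union] at h1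
      exact h1.1.resolve_right he2.2
  have hcard : (Finset.univ ×ˢ (G.edgeFinset \ TE).powerset :
      Finset (Equiv.Perm (Fin m) × Finset (Sym2 (Fin m)))).card ≤
      (m * ∏ u : Fin m, (G.degree u + 1) ^ 2) * X.toFinite.toFinset.card := by
    apply Finset.card_le_mul_card_image_of_maps_to (f := fun x => (H x.2).comap x.1)
    · rintro ⟨σ, P⟩ hx
      simp only [Finset.mem_product, Finset.mem_powerset] at hx
      simp only [Set.Finite.mem_toFinset]
      exact hX _ _ (hHle _ (hx.2.trans Finset.sdiff_subset))
    · intro L _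
      rcases Finset.eq_empty_or_nonempty ((Finset.univ ×ˢ (G.edgeFinset \ TE).powerset :
        Finset (Equiv.Perm (Fin m) × Finset (Sym2 (Fin m)))).filter
          (fun x => (H x.2).comap x.1 = L)) with hE | ⟨⟨σ0, P0⟩, h0⟩
      · rw [hE]; simp
      · simp only [Finset.mem_filter, Finset.mem_product, Finset.mem_powerset] at h0
        rw [← Finset.card_image_of_injOn (f := fun x => σ0.symm.trans x.1)]
        · apply perm_code_bound G p s hp hinj r hr
          intro τ hτ i hi
          simp only [Finset.mem_image, Finset.mem_filter, Finset.mem_product,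
            Finset.mem_powerset] at hτ
          obtain ⟨⟨σ, P⟩, ⟨⟨_, hP⟩, hL⟩, rfl⟩ := hτ
          apply hHle P (hP.trans Finset.sdiff_subset)
          have : ((H P0).comap σ0).Adj (σ0.symm i) (σ0.symm (p i)) := by
            simpa using hHT P0 i hi
          rw [h0.2, ← hL] at this
          simpa using this
        · rintro ⟨σ, P⟩ h1 ⟨σ', P'⟩ h2 h
          simp only [Finset.coe_filter, Finset.mem_product, Finset.mem_powerset,
            Set.mem_ofPred_eq] at h1 h2
          have hσ : σ = σ' := by
            ext i
            have := congrArg (fun e : Equiv.Perm (Fin m) => e (σ0 i)) h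
            simpa using congrArg Fin.val this
          subst hσ
          have hHH : H P = H P' := by
            ext a b
            have h3 := h1.2.trans h2.2.symm
            have h4 : ((H P).comap σ).Adj (σ.symm a) (σ.symm b) ↔
              ((H P').comap σ).Adj (σ.symm a) (σ.symm b) := by rw [h3]
            simpa using h4
          have : P = P' := Finset.Subset.antisymm (hHinj _ h1.1.2 _ h2.1.2 hHH)
            (hHinj _ h2.1.2 _ h1.1.2 hHH.symm)
          rw [this]
  rw [Finset.card_product, Finset.card_univ, Fintype.card_perm, Fintype.card_fin,
    Finset.card_powerset, ← Set.ncard_eq_toFinset_card X] at hcard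
  have hE : G.edgeFinset.card ≤ (G.edgeFinset \ TE).card + m := by
    have := Finset.card_sdiff_add_card G.edgeFinset TE
    have h2 := Finset.card_le_card (Finset.subset_union_left (s₁ := G.edgeFinset) (s₂ := TE))
    omega
  calc m.factorial * 2 ^ G.edgeFinset.card
      ≤ m.factorial * 2 ^ ((G.edgeFinset \ TE).card + m) := by gcongr; norm_num
    _ = (m.factorial * 2 ^ (G.edgeFinset \ TE).card) * 2 ^ m := by ring
    _ ≤ _ := Nat.mul_le_mul_right _ hcard

lemma prod_bound {m : ℕ} (a : Fin m → ℕ) (Q : ℝ) (hQ : 0 < Q)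
    (h : (∑ u, (a u : ℝ)) ≤ Q * m) : (∏ u, (a u : ℝ)) ≤ Q ^ m := by
  calc (∏ u, (a u : ℝ)) ≤ ∏ u, (Q * Real.exp (a u / Q - 1)) := by
        apply Finset.prod_le_prod
        · intros; positivity
        · intro u _
          have := Real.add_one_le_exp ((a u : ℝ) / Q - 1)
          calc (a u : ℝ) = Q * (a u / Q - 1 + 1) := by field_simp; ring
            _ ≤ _ := by gcongr
    _ = Q ^ m * Real.exp ((∑ u, (a u : ℝ)) / Q - m) := by
        rw [Finset.prod_mul_distrib, ← Real.exp_sum, Finset.sum_sub_distrib, Finset.sum_div]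
        simp
    _ ≤ Q ^ m * 1 := by
        gcongr
        rw [← Real.exp_zero]
        apply Real.exp_le_exp.mpr
        have : (∑ u, (a u : ℝ)) / Q ≤ m := by rw [div_le_iff₀ hQ]; linarith
        linarith
    _ = Q ^ m := by ring

/-- Number of ordered adjacent pairs inside a vertex set. -/
noncomputable def epairs {V : Type} [DecidableEq V] (G : SimpleGraph V) (S : Finset V) : ℕ :=
  by
  classical exact ((S ×ˢ S).filter (fun x => G.Adj x.1 x.2)).card

/-- A rooted binary tree in `G[S]`, listed in an order where parents come first. -/
structure IsTreeSeq {V : Type} (G : SimpleGraph V) (S : Finset V) (m : ℕ)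
    (y : ℕ → V) (p : ℕ → ℕ) (s : ℕ → Bool) : Prop where
  mem : ∀ i < m, y i ∈ S
  inj : ∀ i < m, ∀ j < m, y i = y j → i = j
  par : ∀ i < m, i ≠ 0 → p i < i
  adj : ∀ i < m, i ≠ 0 → G.Adj (y i) (y (p i))
  slot : ∀ i < m, ∀ j < m, i ≠ 0 → j ≠ 0 → p i = p j → s i = s j → i = j

lemma IsTreeSeq.card_image {V : Type} [DecidableEq V] {G : SimpleGraph V} {S : Finset V} {m : ℕ}
    {y : ℕ → V} {p : ℕ → ℕ} {s : ℕ → Bool} (h : IsTreeSeq G S m y p s) :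
    ((Finset.range m).image y).card = m := by
  rw [Finset.card_image_of_injOn, Finset.card_range]
  intro i hi j hj hij
  exact h.inj i (by simpa using hi) j (by simpa using hj) hij

lemma IsTreeSeq.le_card {V : Type} [DecidableEq V] {G : SimpleGraph V} {S : Finset V} {m : ℕ}
    {y : ℕ → V} {p : ℕ → ℕ} {s : ℕ → Bool} (h : IsTreeSeq G S m y p s) : m ≤ S.card := by
  rw [← h.card_image]
  apply Finset.card_le_card
  intro v hv
  simp only [Finset.mem_image, Finset.mem_range] at hv
  obtain ⟨i, hi, rfl⟩ := hv
  exact h.mem i hi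

lemma IsTreeSeq.extend {V : Type} [DecidableEq V] {G : SimpleGraph V} {S : Finset V} {m : ℕ}
    {y : ℕ → V} {p : ℕ → ℕ} {s : ℕ → Bool} (h : IsTreeSeq G S m y p s)
    (v : V) (hvS : v ∈ S) (hv : ∀ i < m, y i ≠ v) (j : ℕ) (hj : j < m) (b : Bool)
    (hadj : G.Adj v (y j)) (hb : ¬ ∃ i < m, i ≠ 0 ∧ p i = j ∧ s i = b) :
    IsTreeSeq G S (m + 1) (Function.update y m v) (Function.update p m j)
      (Function.update s m b) := by
  push Not at hb
  constructor
  · intro i hi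
    by_cases him : i = m
    · subst him; simpa using hvS
    · simpa [him] using h.mem i (by omega)
  · intro i hi k hk hik
    by_cases him : i = m <;> by_cases hkm : k = m
    · omega
    · simp only [him, Function.update_self, Function.update_of_ne hkm] at hik
      exact absurd hik.symm (hv k (by omega))
    · simp only [hkm, Function.update_self, Function.update_of_ne him] at hik
      exact absurd hik (hv i (by omega))
    · simp only [Function.update_of_ne him, Function.update_of_ne hkm] at hik
      exact h.inj i (by omega) k (by omega) hik
  · intro i hi h0
    by_cases him : i = m
    · subst him; simpa using hj
    · simpa [him] using h.par i (by omega) h0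
  · intro i hi h0
    by_cases him : i = m
    · subst him
      rw [Function.update_self, Function.update_self, Function.update_of_ne (by omega)]
      exact hadj
    · have h1 := h.par i (by omega) h0
      rw [Function.update_of_ne him, Function.update_of_ne him, Function.update_of_ne (by omega)]
      exact h.adj i (by omega) h0
  · intro i hi k hk hi0 hk0 hpp hss
    by_cases him : i = m <;> by_cases hkm : k = m
    · omega
    · simp only [him, Function.update_self, Function.update_of_ne hkm] at hpp hss
      exact absurd hss.symm (hb k (by omega) hk0 hpp.symm)
    · simp only [hkm, Function.update_self, Function.update_of_ne him] at hpp hss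
      exact absurd hss (hb i (by omega) hi0 hpp)
    · simp only [Function.update_of_ne him, Function.update_of_ne hkm] at hpp hss
      exact h.slot i (by omega) k (by omega) hi0 hk0 hpp hss

lemma exists_tree {V : Type} [DecidableEq V] (G : SimpleGraph V) (S : Finset V)
    (hS : S.Nonempty) (q : ℝ) (hq : 0 ≤ q) (hSq : (epairs G S : ℝ) = q * S.card)
    (hmax : ∀ T : Finset V, (epairs G T : ℝ) ≤ q * T.card) :
    ∃ (m : ℕ) (y : ℕ → V) (p : ℕ → ℕ) (s : ℕ → Bool), 0 < m ∧ IsTreeSeq G S m y p s ∧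
      q * m / 2 ≤ epairs G ((Finset.range m).image y) := by
  classical
  let P : ℕ → Prop := fun m => ∃ (y : ℕ → V) (p : ℕ → ℕ) (s : ℕ → Bool), IsTreeSeq G S m y p s
  obtain ⟨v0, hv0⟩ := hS
  have hP1 : P 1 := by
    refine ⟨fun _ => v0, fun _ => 0, fun _ => true, ⟨fun _ _ => hv0, ?_, ?_, ?_, ?_⟩⟩ <;>
      intros <;> omega
  have hS1 : 1 ≤ S.card := Finset.card_pos.mpr ⟨v0, hv0⟩
  set m := Nat.findGreatest P S.card with hm
  have hPm : P m := Nat.findGreatest_spec hS1 hP1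
  have hm1 : 1 ≤ m := Nat.le_findGreatest hS1 hP1
  have hnot : ¬ P (m + 1) := by
    rintro ⟨y, p, s, h⟩
    have := Nat.le_findGreatest (P := P) h.le_card ⟨y, p, s, h⟩
    omega
  obtain ⟨y, p, s, h⟩ := hPm
  refine ⟨m, y, p, s, hm1, h, ?_⟩
  set Y := (Finset.range m).image y with hY
  have hYS : Y ⊆ S := by
    intro v hv
    simp only [hY, Finset.mem_image, Finset.mem_range] at hv
    obtain ⟨i, hi, rfl⟩ := hv
    exact h.mem i hi
  let I := (Finset.range m).filter (fun j => ∀ b : Bool, ∃ i < m, i ≠ 0 ∧ p i = j ∧ s i = b)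
  let A := I.image y
  have hI : 2 * I.card ≤ m := by
    have : (I ×ˢ (Finset.univ : Finset Bool)) ⊆ (Finset.range m).image (fun i => (p i, s i)) := by
      rintro ⟨j, b⟩ hjb
      simp only [I, Finset.mem_product, Finset.mem_filter, Finset.mem_univ, and_true] at hjb
      obtain ⟨i, hi, _, h1, h2⟩ := hjb.2 b
      simp only [Finset.mem_image, Finset.mem_range]
      exact ⟨i, hi, by rw [h1, h2]⟩
    have h1 := (Finset.card_le_card this).trans Finset.card_image_le
    simp at h1
    omega
  have hAc : A.card ≤ I.card := Finset.card_image_le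
  have hclosed : ∀ u v, u ∈ S → u ∉ Y → v ∈ Y → G.Adj u v → v ∈ A := by
    intro u v huS huY hvY huv
    simp only [hY, Finset.mem_image, Finset.mem_range] at hvY
    obtain ⟨j, hj, rfl⟩ := hvY
    by_contra hA
    apply hnot
    have : ¬ ∀ b : Bool, ∃ i < m, i ≠ 0 ∧ p i = j ∧ s i = b := by
      intro hb
      exact hA (Finset.mem_image_of_mem _ (by simp only [I, Finset.mem_filter, Finset.mem_range];
                                              exact ⟨hj, hb⟩))
    rw [not_forall] at this
    obtain ⟨b, hb⟩ := this
    refine ⟨_, _, _, h.extend u huS ?_ j hj b huv hb⟩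
    rintro i hi rfl
    exact huY (Finset.mem_image_of_mem _ (by simpa using hi))
  have hle : epairs G S ≤ epairs G Y + epairs G ((S \ Y) ∪ A) := by
    unfold epairs
    refine le_trans (Finset.card_le_card ?_) (Finset.card_union_le _ _)
    rintro ⟨u, v⟩ huv
    simp only [Finset.mem_filter, Finset.mem_product, Finset.mem_union, Finset.mem_sdiff] at huv ⊢
    obtain ⟨⟨hu, hv⟩, hadj⟩ := huv
    by_cases hu' : u ∈ Y <;> by_cases hv' : v ∈ Y
    · left; exact ⟨⟨hu', hv'⟩, hadj⟩
    · right; exact ⟨⟨Or.inr (hclosed v u hv hv' hu' hadj.symm), Or.inl ⟨hv, hv'⟩⟩, hadj⟩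
    · right; exact ⟨⟨Or.inl ⟨hu, hu'⟩, Or.inr (hclosed u v hu hu' hv' hadj)⟩, hadj⟩
    · right; exact ⟨⟨Or.inl ⟨hu, hu'⟩, Or.inl ⟨hv, hv'⟩⟩, hadj⟩
  have hc : (((S \ Y) ∪ A).card : ℝ) ≤ S.card - m + m / 2 := by
    have h1 := Finset.card_union_le (S \ Y) A
    have h2 := Finset.card_sdiff_add_card_eq_card hYS
    have h3 : Y.card = m := h.card_image
    have h4 : ((S \ Y).card : ℝ) + m = S.card := by rw [h3] at h2; exact_mod_cast h2
    have h5 : (((S \ Y) ∪ A).card : ℝ) ≤ (S \ Y).card + I.card := by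
      exact_mod_cast h1.trans (by omega)
    have h6 : 2 * (I.card : ℝ) ≤ m := by exact_mod_cast hI
    linarith
  have h1 := hmax ((S \ Y) ∪ A)
  have h2 : (epairs G S : ℝ) ≤ epairs G Y + epairs G ((S \ Y) ∪ A) := by exact_mod_cast hle
  have h3 := mul_le_mul_of_nonneg_left hc hq
  rw [hSq] at h2
  linarith

lemma sum_degree_comap {n m : ℕ} (G : SimpleGraph (Fin n)) (y : Fin m → Fin n)
    (hy : Function.Injective y) [DecidableRel (G.comap y).Adj] :
    ∑ u, (G.comap y).degree u = epairs G (Finset.univ.image y) := by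
  classical
  unfold epairs
  rw [Finset.card_filter, Finset.sum_product, Finset.sum_image (fun _ _ _ _ h => hy h)]
  apply Finset.sum_congr rfl
  intro u _
  rw [Finset.sum_image (fun _ _ _ _ h => hy h), ← SimpleGraph.card_neighborFinset_eq_degree,
    SimpleGraph.neighborFinset_eq_filter, Finset.card_filter]
  simp

lemma growth (c : ℝ) (hc : 0 < c) :
    ∃ D : ℕ, ∀ q : ℝ, (D : ℝ) ≤ q → 4 * c * (q + 1) ^ 2 < (2 : ℝ) ^ (q / 4) := by
  have h := tendsto_exp_mul_div_rpow_atTop 2 (Real.log 2 / 4) (by positivity)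
  have h2 := (h.eventually_gt_atTop (16 * c)).and (Filter.eventually_ge_atTop 1)
  obtain ⟨D, hD⟩ := Filter.eventually_atTop.mp h2
  refine ⟨⌈D⌉₊, fun q hq => ?_⟩
  obtain ⟨h3, h4⟩ := hD q ((Nat.le_ceil D).trans hq)
  rw [Real.rpow_two, lt_div_iff₀ (by positivity)] at h3
  rw [Real.rpow_def_of_pos (by norm_num)]
  have h5 : Real.log 2 / 4 * q = Real.log 2 * (q / 4) := by ring
  rw [h5] at h3
  refine lt_of_le_of_lt ?_ h3
  have h6 : (q + 1) ^ 2 ≤ 4 * q ^ 2 := by nlinarith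
  nlinarith

lemma final_ineq (m E : ℕ) (f Pr N c q : ℝ) (hm : m ≠ 0) (hf : 0 < f) (hP0 : 0 ≤ Pr)
    (hN0 : 0 ≤ N) (hc : 0 < c) (hq : 0 ≤ q) (hR : f * 2 ^ E ≤ (m * Pr ^ 2) * N * 2 ^ m)
    (hP : Pr ≤ (q + 1) ^ m) (hN : N ≤ f * c ^ m) (hE : q / 4 * m ≤ (E : ℝ))
    (hlt : 4 * c * (q + 1) ^ 2 < (2 : ℝ) ^ (q / 4)) : False := by
  have hm2 : (m : ℝ) ≤ 2 ^ m := by exact_mod_cast Nat.lt_two_pow_self.le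
  have hfin : f * 2 ^ E ≤ f * (4 * c * (q + 1) ^ 2) ^ m := by
    calc _ ≤ _ := hR
      _ ≤ (2 ^ m * ((q + 1) ^ m) ^ 2) * (f * c ^ m) * 2 ^ m := by gcongr
      _ = _ := by
          have : (4 : ℝ) ^ m = 2 ^ m * 2 ^ m := by rw [← mul_pow]; norm_num
          rw [mul_pow, mul_pow, this, ← pow_mul, ← pow_mul, mul_comm m 2]
          generalize (q + 1) ^ (2 * m) = z
          ring
  have hfin2 := le_of_mul_le_mul_left hfin hf
  have hlow : ((2 : ℝ) ^ (q / 4)) ^ m ≤ 2 ^ E := by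
    rw [← Real.rpow_natCast, ← Real.rpow_mul (by norm_num), ← Real.rpow_natCast 2]
    exact Real.rpow_le_rpow_of_exponent_le (by norm_num) hE
  have hlt : (4 * c * (q + 1) ^ 2) ^ m < ((2 : ℝ) ^ (q / 4)) ^ m :=
    pow_lt_pow_left₀ hlt (by positivity) hm
  linarith

/-- Every monotone small graph class (i.e. `|𝒳ₙ| ≤ n! * cⁿ` for some
constant `c > 0`) has bounded degeneracy: some constant `d` such that every graph in the
class is `d`-degenerate. -/
theorem monotone_small_bounded_degeneracy (𝒳 : GraphClass)
    (hmono : MonotoneGraphClass 𝒳)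
    (hsmall : ∃ c : ℝ, 0 < c ∧
      ∀ n : ℕ, ((𝒳 n).ncard : ℝ) ≤ (n.factorial : ℝ) * c ^ n) :
    ∃ d : ℕ, ∀ n : ℕ, ∀ G ∈ 𝒳 n, Degenerate d G := by
  classical
  obtain ⟨c, hc, hsm⟩ := hsmall
  obtain ⟨D, hD⟩ := growth c hc
  refine ⟨D, fun n G hG => ?_⟩
  by_contra hdeg
  unfold Degenerate at hdeg
  push Not at hdeg
  obtain ⟨A, hA, hAd⟩ := hdeg
  -- a densest set
  obtain ⟨S, hS, hSmax⟩ := Finset.exists_max_image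
    ((Finset.univ : Finset (Finset (Fin n))).filter (fun S => S.Nonempty))
    (fun S => (epairs G S : ℝ) / S.card) ⟨A, by simpa using hA⟩
  simp only [Finset.mem_filter, Finset.mem_univ, true_and] at hS hSmax
  set q : ℝ := (epairs G S : ℝ) / S.card with hq
  have hq0 : 0 ≤ q := by positivity
  have hSq : (epairs G S : ℝ) = q * S.card := by
    have : (S.card : ℝ) ≠ 0 := by exact_mod_cast hS.card_pos.ne'
    rw [hq]; field_simp
  have hmax : ∀ T : Finset (Fin n), (epairs G T : ℝ) ≤ q * T.card := by
    intro T
    rcases T.eq_empty_or_nonempty with rfl | hT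
    · simp [epairs]
    · have : (0 : ℝ) < T.card := by exact_mod_cast hT.card_pos
      exact (div_le_iff₀ this).mp (hSmax T hT)
  have hqD : (D : ℝ) ≤ q := by
    have h1 : D * A.card ≤ epairs G A := by
      unfold epairs
      rw [Finset.card_filter, Finset.sum_product, mul_comm, ← smul_eq_mul]
      apply Finset.card_nsmul_le_sum
      intro v hv
      rw [← Finset.card_filter]
      have h2 := hAd v hv
      have h3 : ((A : Set (Fin n)) ∩ G.neighborSet v) =
          ((A.filter (fun w => G.Adj v w) : Finset (Fin n)) : Set (Fin n)) := by
        ext w; simp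
      rw [h3, Set.ncard_coe_finset] at h2
      exact h2.le
    have h2 : (0 : ℝ) < A.card := by exact_mod_cast hA.card_pos
    have h3 : (D : ℝ) * A.card ≤ q * A.card :=
      le_trans (by exact_mod_cast h1) (hmax A)
    exact le_of_mul_le_mul_right h3 h2
  obtain ⟨m, y, p, s, hm, htree, hYe⟩ := exists_tree G S hS q hq0 hSq hmax
  let y' : Fin m → Fin n := fun i => y i
  have hy' : Function.Injective y' := fun i j hij =>
    Fin.ext (htree.inj i i.2 j j.2 hij)
  have hYimg : (Finset.range m).image y = Finset.univ.image y' := by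
    ext v
    simp only [Finset.mem_image, Finset.mem_range, Finset.mem_univ, true_and, y']
    exact ⟨fun ⟨i, hi, h⟩ => ⟨⟨i, hi⟩, h⟩, fun ⟨i, h⟩ => ⟨i, i.2, h⟩⟩
  let p' : Fin m → Fin m := fun i =>
    if h : i.val ≠ 0 then ⟨p i, (htree.par i i.2 h).trans i.2⟩ else i
  have hp'v : ∀ i : Fin m, i.val ≠ 0 → (p' i).val = p i := by
    intro i hi; simp [p', hi]
  have hcount := counting (G.comap y') p' (fun i => s i)
    (fun i hi => by
      rw [Fin.lt_def, hp'v i hi]; exact htree.par i i.2 hi)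
    (fun i hi => by
      simp only [SimpleGraph.comap_adj, y']
      rw [hp'v i hi]; exact htree.adj i i.2 hi)
    (fun i j hi hj h1 h2 => Fin.ext (htree.slot i i.2 j j.2 hi hj
      (by rw [← hp'v i hi, ← hp'v j hj, h1]) h2))
    ⟨0, hm⟩ rfl (𝒳 m)
    (fun H σ hH => hmono _ G hG
      ⟨⟨fun i => y' (σ i), fun i j hij => σ.injective (hy' hij)⟩, fun u v huv => hH huv⟩)
  have hsum := sum_degree_comap G y' hy'
  have h2E := (G.comap y').sum_degrees_eq_twice_card_edges
  rw [hYimg] at hYe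
  have hub := hmax (Finset.univ.image y')
  rw [← hYimg, htree.card_image, hYimg] at hub
  rw [← hsum] at hub hYe
  have hE : q / 4 * m ≤ ((G.comap y').edgeFinset.card : ℝ) := by
    rw [h2E] at hYe
    push_cast at hYe
    linarith
  have hprod : (∏ u, (((G.comap y').degree u + 1 : ℕ) : ℝ)) ≤ (q + 1) ^ m := by
    apply prod_bound _ _ (by linarith)
    push_cast at hub ⊢
    rw [Finset.sum_add_distrib]
    simp only [Finset.sum_const, Finset.card_univ, Fintype.card_fin, nsmul_eq_mul, mul_one]
    linarith
  have hfac : (0 : ℝ) < m.factorial := by exact_mod_cast m.factorial_pos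
  have hR : (m.factorial : ℝ) * 2 ^ (G.comap y').edgeFinset.card ≤
      (m * (∏ u, (((G.comap y').degree u + 1 : ℕ) : ℝ)) ^ 2) * (𝒳 m).ncard * 2 ^ m := by
    rw [← Finset.prod_pow]
    exact_mod_cast hcount
  exact final_ineq m _ _ _ _ c q hm.ne' hfac (Finset.prod_nonneg fun _ _ => Nat.cast_nonneg _)
    (Nat.cast_nonneg _) hc hq0 hR hprod (hsm m) hE (hD q hqD)
end

section
/- Every monotone small class of graphs admits an implicit representation: if 𝒳 is a monotone class with |𝒳ₙ| ≤ n!·cⁿ for all n for some constant c > 0, then there exists a constant C such that 𝒳 admits a (C·⌈log₂ n⌉)-bit adjacency labeling scheme. -/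
open Real

/-- `𝒳` admits a `b n`-bit adjacency labeling scheme: there is a decoder `D` such that every
`n`-vertex graph in `𝒳` has a labeling of its vertices by binary strings of length `b n`
from which `D` decodes adjacency. -/
def HasScheme (𝒳 : GraphClass) (b : ℕ → ℕ) : Prop :=
  ∃ D : List Bool → List Bool → Bool,
    ∀ n : ℕ, ∀ G ∈ 𝒳 n, ∃ ℓ : Fin n → List Bool,
      (∀ v, (ℓ v).length = b n) ∧
      ∀ u v : Fin n, u ≠ v → (D (ℓ u) (ℓ v) = true ↔ G.Adj u v)


section helpers
open Finset

theorem aux_hom_sum {V : Type*} [Fintype V] (w : V → V → ℝ) (hw0 : ∀ x y, 0 ≤ w x y)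
    (hw : ∀ x, ∑ y, w x y ≤ 1) (q : ℕ → ℕ) (hq : ∀ i, q i ≤ i) (k : ℕ) :
    ∑ φ : Fin (k+1) → V, ∏ i : Fin k,
      w (φ ⟨q i, by have := hq i; omega⟩) (φ i.succ) ≤ Fintype.card V := by
  induction k with
  | zero => simp
  | succ k ih =>
    refine le_trans ?_ ih
    rw [← (Fin.snocEquiv (fun _ : Fin (k+2) => V)).sum_comp, Fintype.sum_prod_type_right]
    refine Finset.sum_le_sum fun ψ _ => ?_
    have key : ∀ y : V, (∏ i : Fin (k+1),
        w ((Fin.snocEquiv (fun _ : Fin (k+2) => V)) (y, ψ) ⟨q i, by have := hq i; omega⟩)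
          ((Fin.snocEquiv (fun _ : Fin (k+2) => V)) (y, ψ) i.succ)) =
        (∏ i : Fin k, w (ψ ⟨q i, by have := hq i; omega⟩) (ψ i.succ)) *
          w (ψ ⟨q k, by have := hq k; omega⟩) y := by
      intro y
      rw [Fin.prod_univ_castSucc]
      congr 1
      · refine Finset.prod_congr rfl fun i _ => ?_
        have h1 := hq i
        have h2 := i.2
        simp only [Fin.snocEquiv, Equiv.coe_fn_mk, Fin.snoc, Fin.val_castSucc, Fin.val_succ]
        rw [dif_pos (by omega), dif_pos (by omega)]
        rfl
      · have h1 := hq k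
        simp only [Fin.snocEquiv, Equiv.coe_fn_mk, Fin.snoc, Fin.val_last, Fin.val_succ]
        rw [dif_pos (by omega), dif_neg (by omega)]
        rfl
    simp_rw [key]
    rw [← Finset.mul_sum]
    exact mul_le_of_le_one_right (Finset.prod_nonneg fun i _ => hw0 _ _) (hw _)

open Classical in
theorem aux_emb_bound (k : ℕ) (H : SimpleGraph (Fin (k+1))) (q : ℕ → ℕ) (hq : ∀ i, q i ≤ i)
    (hf : ∀ j, #{i ∈ range k | q i = j} ≤ 2) :
    ((#{φ : Equiv.Perm (Fin (k+1)) | ∀ i : Fin k,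
        H.Adj (φ ⟨q i, by have := hq i; omega⟩) (φ i.succ)} : ℕ) : ℝ) ≤
      (k+1) * ∏ v, ((H.degree v : ℝ) + 1) ^ 2 := by
  set w : Fin (k+1) → Fin (k+1) → ℝ := fun x y => if H.Adj x y then 1 / ((H.degree x : ℝ) + 1) else 0
    with hwdef
  have hpos : ∀ x, (0:ℝ) < (H.degree x : ℝ) + 1 := fun x => by positivity
  have hw0 : ∀ x y, 0 ≤ w x y := by
    intro x y; simp only [hwdef]; split_ifs <;> positivity
  have hw : ∀ x, ∑ y, w x y ≤ 1 := by
    intro x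
    simp only [hwdef]
    rw [← Finset.sum_filter, Finset.sum_const, nsmul_eq_mul, ← SimpleGraph.neighborFinset_eq_filter,
      SimpleGraph.card_neighborFinset_eq_degree, mul_one_div, div_le_one (hpos x)]
    linarith
  have h1 := aux_hom_sum w hw0 hw q hq k
  rw [Fintype.card_fin] at h1
  set E : Finset (Equiv.Perm (Fin (k+1))) := {φ : Equiv.Perm (Fin (k+1)) | ∀ i : Fin k,
        H.Adj (φ ⟨q i, by have := hq i; omega⟩) (φ i.succ)} with hE
  set P := ∏ v, ((H.degree v : ℝ) + 1) ^ 2 with hP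
  have hPpos : 0 < P := Finset.prod_pos fun v _ => pow_pos (hpos v) 2
  have h2 : ∀ φ ∈ E, 1 / P ≤ ∏ i : Fin k,
      w (φ ⟨q i, by have := hq i; omega⟩) (φ i.succ) := by
    intro φ hφ
    have hφ' := (Finset.mem_filter.1 hφ).2
    have e1 : ∏ i : Fin k, w (φ ⟨q i, by have := hq i; omega⟩) (φ i.succ)
        = 1 / ∏ i : Fin k, ((H.degree (φ ⟨q i, by have := hq i; omega⟩) : ℝ) + 1) := by
      rw [one_div, ← Finset.prod_inv_distrib]
      refine Finset.prod_congr rfl fun i _ => ?_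
      simp only [hwdef]
      rw [if_pos (hφ' i), one_div]
    rw [e1]
    apply one_div_le_one_div_of_le (Finset.prod_pos fun i _ => hpos _)
    have e2 : P = ∏ v, ((H.degree (φ v) : ℝ) + 1) ^ 2 :=
      (Equiv.prod_comp φ (fun v => ((H.degree v : ℝ) + 1) ^ 2)).symm
    rw [e2]
    rw [← Finset.prod_fiberwise (s := Finset.univ)
      (g := fun i : Fin k => (⟨q i, by have := hq i; omega⟩ : Fin (k+1)))]
    refine Finset.prod_le_prod (fun v _ => Finset.prod_nonneg fun i _ => (hpos _).le) fun v _ => ?_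
    rw [Finset.prod_congr rfl (g := fun _ => ((H.degree (φ v) : ℝ) + 1))]
    · rw [Finset.prod_const]
      apply pow_le_pow_right₀ (by simp)
      refine le_trans ?_ (hf v)
      refine Finset.card_le_card_of_injOn (fun i => (i : ℕ)) ?_ (fun a _ b _ h => Fin.ext h)
      intro i hi
      have := (Finset.mem_filter.1 hi).2
      simp only [Finset.coe_filter, Finset.mem_range, Set.mem_ofPred_eq]
      exact ⟨i.2, congrArg Fin.val this⟩
    · intro i hi
      rw [(Finset.mem_filter.1 hi).2]
  have h3 : (#E : ℝ) * (1 / P) ≤ k + 1 := by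
    calc (#E : ℝ) * (1 / P) = ∑ φ ∈ E, 1 / P := by rw [Finset.sum_const, nsmul_eq_mul]
      _ ≤ ∑ φ ∈ E, ∏ i : Fin k, w (φ ⟨q i, by have := hq i; omega⟩) (φ i.succ) :=
          Finset.sum_le_sum h2
      _ = ∑ f ∈ E.image (fun φ : Equiv.Perm (Fin (k+1)) => (φ : Fin (k+1) → Fin (k+1))),
            ∏ i : Fin k, w (f ⟨q i, by have := hq i; omega⟩) (f i.succ) := by
          rw [Finset.sum_image]
          intro a _ b _ h
          exact DFunLike.coe_injective h
      _ ≤ _ := Finset.sum_le_univ_sum_of_nonneg fun f => Finset.prod_nonneg fun i _ => hw0 _ _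
      _ ≤ _ := by exact_mod_cast h1
  rw [mul_one_div, div_le_iff₀ hPpos] at h3
  exact h3

open Classical in
theorem aux_count (k : ℕ) (H : SimpleGraph (Fin (k+1))) (q : ℕ → ℕ) (hq : ∀ i, q i ≤ i)
    (hadj : ∀ i : Fin k, H.Adj ⟨q i, by have := hq i; omega⟩ i.succ)
    (Y : Set (SimpleGraph (Fin (k+1))))
    (hY : ∀ (E : SimpleGraph (Fin (k+1))) (σ : Equiv.Perm (Fin (k+1))), E ≤ H →
      E.map σ.toEmbedding ∈ Y) :
    (k+1).factorial * 2 ^ (#H.edgeFinset - k) ≤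
      #{φ : Equiv.Perm (Fin (k+1)) | ∀ i : Fin k,
        H.Adj (φ ⟨q i, by have := hq i; omega⟩) (φ i.succ)} * Y.ncard := by
  set T : Finset (Sym2 (Fin (k+1))) :=
    Finset.univ.image fun i : Fin k => s(⟨q i, by have := hq i; omega⟩, i.succ) with hT
  have hTH : T ⊆ H.edgeFinset := by
    intro e he
    obtain ⟨i, _, rfl⟩ := Finset.mem_image.1 he
    simpa using hadj i
  have hTc : #T ≤ k := by
    refine Finset.card_image_le.trans (by simp)
  set g : Finset (Sym2 (Fin (k+1))) → SimpleGraph (Fin (k+1)) := fun S =>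
    SimpleGraph.fromEdgeSet ((S ∪ T : Finset _) : Set (Sym2 (Fin (k+1)))) with hg
  set Q := (H.edgeFinset \ T).powerset with hQ
  have hgS : ∀ S ∈ Q, (g S).edgeSet = ((S ∪ T : Finset _) : Set (Sym2 (Fin (k+1)))) := by
    intro S hS
    simp only [hg, SimpleGraph.edgeSet_fromEdgeSet]
    rw [sdiff_eq_left, Set.disjoint_left]
    intro e he hd
    have : e ∈ H.edgeFinset := by
      rcases Finset.mem_union.1 (Finset.mem_coe.1 he) with h | h
      · exact (Finset.mem_sdiff.1 (Finset.mem_powerset.1 hS h)).1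
      · exact hTH h
    exact H.not_isDiag_of_mem_edgeFinset this hd
  have hgH : ∀ S ∈ Q, g S ≤ H := by
    intro S hS
    rw [← SimpleGraph.edgeSet_subset_edgeSet, hgS S hS]
    intro e he
    rw [← SimpleGraph.mem_edgeFinset]
    rcases Finset.mem_union.1 (Finset.mem_coe.1 he) with h | h
    · exact (Finset.mem_sdiff.1 (Finset.mem_powerset.1 hS h)).1
    · exact hTH h
  have hginj : ∀ S ∈ Q, ∀ S' ∈ Q, g S = g S' → S = S' := by
    intro S hS S' hS' h
    have h1 : S ∪ T = S' ∪ T := by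
      rw [← Finset.coe_inj, ← hgS S hS, ← hgS S' hS', h]
    have d1 : ∀ S ∈ Q, S = (S ∪ T) \ T := by
      intro S hS
      rw [Finset.union_sdiff_right, eq_comm, sdiff_eq_left, Finset.disjoint_left]
      intro e he
      exact (Finset.mem_sdiff.1 (Finset.mem_powerset.1 hS he)).2
    rw [d1 S hS, d1 S' hS', h1]
  set f : Finset (Sym2 (Fin (k+1))) × Equiv.Perm (Fin (k+1)) → SimpleGraph (Fin (k+1)) :=
    fun x => (g x.1).map x.2.toEmbedding with hf
  set EE : Finset (Equiv.Perm (Fin (k+1))) := {φ : Equiv.Perm (Fin (k+1)) | ∀ i : Fin k,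
        H.Adj (φ ⟨q i, by have := hq i; omega⟩) (φ i.succ)} with hEE
  have main := Finset.card_le_mul_card_image (f := f) (Q ×ˢ (Finset.univ)) #EE (by
    intro Γ hΓ
    obtain ⟨⟨S₀, σ₀⟩, h0, rfl⟩ := Finset.mem_image.1 hΓ
    have h0' : S₀ ∈ Q := (Finset.mem_product.1 h0).1
    refine Finset.card_le_card_of_injOn (fun x => x.2.trans σ₀.symm) ?_ ?_
    · rintro ⟨S, σ⟩ hx
      have hx' := Finset.mem_filter.1 hx
      have hS : S ∈ Q := (Finset.mem_product.1 hx'.1).1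
      have hEq : (g S).map σ.toEmbedding = (g S₀).map σ₀.toEmbedding := hx'.2
      simp only [hEE, Finset.coe_filter, Finset.mem_univ, true_and, Set.mem_ofPred_eq]
      intro i
      have a1 : (g S).Adj ⟨q i, by have := hq i; omega⟩ i.succ := by
        rw [← SimpleGraph.mem_edgeSet, hgS S hS, Finset.mem_coe]
        exact Finset.mem_union_right _ (Finset.mem_image_of_mem _ (Finset.mem_univ i))
      have a2 : ((g S).map σ.toEmbedding).Adj (σ ⟨q i, by have := hq i; omega⟩) (σ i.succ) := by
        have := (SimpleGraph.map_adj_apply (G := g S) (f := σ.toEmbedding)).2 a1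
        exact this
      rw [hEq] at a2
      apply hgH S₀ h0'
      have a3 := (SimpleGraph.map_adj_apply (G := g S₀) (f := σ₀.toEmbedding)
        (a := σ₀.symm (σ ⟨q i, by have := hq i; omega⟩)) (b := σ₀.symm (σ i.succ))).1
      apply a3
      simpa using a2
    · rintro ⟨S, σ⟩ hx ⟨S', σ'⟩ hx' h
      have hx1 := Finset.mem_filter.1 hx
      have hx2 := Finset.mem_filter.1 hx'
      have hσ : σ = σ' := by
        ext v
        have := congrArg (fun e : Equiv.Perm (Fin (k+1)) => e v) h
        simpa using congrArg Fin.val (σ₀.symm.injective this)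
      subst hσ
      have : (g S).map σ.toEmbedding = (g S').map σ.toEmbedding := hx1.2.trans hx2.2.symm
      have := SimpleGraph.map_injective σ.toEmbedding this
      rw [hginj S (Finset.mem_product.1 hx1.1).1 S' (Finset.mem_product.1 hx2.1).1 this])
  have c1 : #(Q ×ˢ (Finset.univ : Finset (Equiv.Perm (Fin (k+1))))) =
      2 ^ (#H.edgeFinset - #T) * (k+1).factorial := by
    rw [Finset.card_product, hQ, Finset.card_powerset, Finset.card_sdiff_of_subset hTH,
      Finset.card_univ, Fintype.card_perm, Fintype.card_fin]
  have c2 : #((Q ×ˢ (Finset.univ)).image f) ≤ Y.ncard := by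
    rw [← Set.ncard_coe_finset]
    apply Set.ncard_le_ncard _ (Set.toFinite _)
    intro Γ hΓ
    obtain ⟨⟨S, σ⟩, h0, rfl⟩ := Finset.mem_image.1 (Finset.mem_coe.1 hΓ)
    exact hY _ _ (hgH S (Finset.mem_product.1 h0).1)
  calc (k+1).factorial * 2 ^ (#H.edgeFinset - k)
      ≤ (k+1).factorial * 2 ^ (#H.edgeFinset - #T) := by
        gcongr
        · norm_num
    _ = _ := by rw [c1, mul_comm]
    _ ≤ _ := main
    _ ≤ _ := by gcongr

open Classical in
/-- Maximal binary tree in a graph of large minimum degree. -/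
theorem aux_tree {N d : ℕ} (G : SimpleGraph (Fin N)) (S : Finset (Fin N)) (hS : S.Nonempty)
    (hd : ∀ v ∈ S, d ≤ #{u ∈ S | G.Adj v u}) :
    ∃ (k : ℕ) (v : Fin (k+1) ↪ Fin N) (q : ℕ → ℕ) (hq : ∀ i, q i ≤ i),
      (∀ i : Fin k, G.Adj (v ⟨q i, by have := hq i; omega⟩) (v i.succ)) ∧
      (∀ j, #{i ∈ range k | q i = j} ≤ 2) ∧
      d * (k + 1) ≤ 4 * #(G.comap v).edgeFinset := by
  let Q : ℕ → Prop := fun k => ∃ (v : ℕ → Fin N) (q : ℕ → ℕ), (∀ i, q i ≤ i) ∧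
    (∀ i ≤ k, v i ∈ S) ∧ (∀ i ≤ k, ∀ j ≤ k, v i = v j → i = j) ∧
    (∀ i < k, G.Adj (v (q i)) (v (i+1))) ∧ (∀ j, #{i ∈ range k | q i = j} ≤ 2)
  have hQ0 : Q 0 := by
    obtain ⟨s, hs⟩ := hS
    refine ⟨fun _ => s, fun i => i, fun i => le_rfl, fun _ _ => hs, ?_, ?_, ?_⟩
    · intro i hi j hj _; omega
    · intro i hi; omega
    · simp
  have hQN : ¬ Q N := by
    rintro ⟨v, q, -, -, hinj, -⟩
    have : Function.Injective (fun i : Fin (N+1) => v i) := by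
      intro a b h
      exact Fin.ext (hinj a (by omega) b (by omega) h)
    have := Fintype.card_le_of_injective _ this
    simp at this
  obtain ⟨k, hk, hk1⟩ : ∃ k, Q k ∧ ¬ Q (k+1) := by
    by_contra hcon
    push Not at hcon
    have : ∀ n, Q n := fun n => by
      induction n with
      | zero => exact hQ0
      | succ n ih => exact hcon n ih
    exact hQN (this N)
  obtain ⟨v, q, hq, hvS, hinj, hadj, hf⟩ := hk
  have hsat : ∀ j ≤ k, #{i ∈ range k | q i = j} < 2 → ∀ u ∈ S, G.Adj (v j) u →
      ∃ i ≤ k, v i = u := by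
    intro j hj hlt u hu hju
    by_contra hcon
    push Not at hcon
    apply hk1
    refine ⟨Function.update v (k+1) u, Function.update q k j, ?_, ?_, ?_, ?_, ?_⟩
    · intro i
      by_cases h : i = k
      · subst h; simpa using hj
      · rw [Function.update_of_ne h]; exact hq i
    · intro i hi
      by_cases h : i = k+1
      · subst h; simpa using hu
      · rw [Function.update_of_ne h]; exact hvS i (by omega)
    · intro i hi i' hi' h
      by_cases h1 : i = k+1
      · by_cases h2 : i' = k+1
        · omega
        · subst h1
          rw [Function.update_self, Function.update_of_ne h2] at h
          exact absurd h.symm (hcon i' (by omega))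
      · by_cases h2 : i' = k+1
        · subst h2
          rw [Function.update_self, Function.update_of_ne h1] at h
          exact absurd h (hcon i (by omega))
        · rw [Function.update_of_ne h1, Function.update_of_ne h2] at h
          exact hinj i (by omega) i' (by omega) h
    · intro i hi
      by_cases h : i = k
      · subst h
        rw [Function.update_self, Function.update_self, Function.update_of_ne (by omega)]
        exact hju
      · have := hq i
        rw [Function.update_of_ne h, Function.update_of_ne (by omega),
          Function.update_of_ne (by omega)]
        exact hadj i (by omega)
    · intro j'
      have hfilt : {i ∈ range k | Function.update q k j i = j'} = {i ∈ range k | q i = j'} := by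
        apply Finset.filter_congr
        intro i hi
        rw [Function.update_of_ne (by have := Finset.mem_range.1 hi; omega)]
      rw [Finset.range_add_one, Finset.filter_insert, hfilt, Function.update_self]
      split_ifs with h
      · subst h
        exact (Finset.card_insert_le _ _).trans (by omega)
      · exact hf j'
  let vE : Fin (k+1) ↪ Fin N := ⟨fun i => v i, fun a b h =>
    Fin.ext (hinj a (by omega) b (by omega) h)⟩
  refine ⟨k, vE, q, hq, ?_, hf, ?_⟩
  · intro i
    exact hadj i i.2
  · set H := G.comap vE with hH
    have hdeg : ∀ j : Fin (k+1), #{i ∈ range k | q i = j} < 2 → d ≤ H.degree j := by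
      intro j hj
      refine (hd (v j) (hvS j (by omega))).trans ?_
      rw [← SimpleGraph.card_neighborFinset_eq_degree, ← Finset.card_map vE]
      apply Finset.card_le_card
      intro u hu
      obtain ⟨huS, hju⟩ := Finset.mem_filter.1 hu
      obtain ⟨i, hi, rfl⟩ := hsat j (by omega) hj u huS hju
      rw [Finset.mem_map]
      refine ⟨⟨i, by omega⟩, ?_, rfl⟩
      rw [SimpleGraph.mem_neighborFinset]
      exact hju
    have hsum : ∑ j : Fin (k+1), #{i ∈ range k | q i = j} = k := by
      rw [Fin.sum_univ_eq_sum_range (fun j => #{i ∈ range k | q i = j}),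
        ← Finset.card_eq_sum_card_fiberwise, Finset.card_range]
      intro i hi
      have := hq i
      simp at hi ⊢
      omega
    have hterm : ∀ j : Fin (k+1), d * 2 ≤ 2 * H.degree j + d * #{i ∈ range k | q i = j} := by
      intro j
      by_cases h : #{i ∈ range k | q i = j} < 2
      · have := hdeg j h
        have : 0 ≤ d * #{i ∈ range k | q i = j} := Nat.zero_le _
        omega
      · have : d * 2 ≤ d * #{i ∈ range k | q i = j} := Nat.mul_le_mul_left _ (by omega)
        omega
    have htot := Finset.sum_le_sum (s := Finset.univ) fun j _ => hterm j
    rw [Finset.sum_add_distrib, ← Finset.mul_sum, ← Finset.mul_sum, ← Finset.mul_sum, hsum,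
      H.sum_degrees_eq_twice_card_edges, Finset.sum_const, Finset.card_univ, Fintype.card_fin,
      smul_eq_mul] at htot
    have hgoal : d * (k+1) ≤ 4 * #H.edgeFinset := by
      nlinarith
    convert hgoal

open Classical in
theorem aux_degenerate (𝒳 : GraphClass) (hmono : MonotoneGraphClass 𝒳)
    (hsmall : ∃ c : ℝ, 0 < c ∧
      ∀ n : ℕ, ((𝒳 n).ncard : ℝ) ≤ (n.factorial : ℝ) * c ^ n) :
    ∃ d : ℕ, ∀ (N : ℕ), ∀ G ∈ 𝒳 N, ∀ S : Finset (Fin N), S.Nonempty →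
      ∃ v ∈ S, #{u ∈ S | G.Adj v u} < d := by
  obtain ⟨c, hc, hX⟩ := hsmall
  obtain ⟨m, hm⟩ := pow_unbounded_of_one_lt (4096 * c) (show (1:ℝ) < 3/2 by norm_num)
  refine ⟨4 * m, fun N G hG S hS => ?_⟩
  by_contra hcon
  push Not at hcon
  obtain ⟨k, v, q, hq, hadj, hf, he⟩ := aux_tree G S hS hcon
  set H := G.comap v with hH
  have h1 := aux_count k H q hq hadj (𝒳 (k+1)) (by
    intro E σ hE
    refine hmono _ G hG ⟨σ.symm.toEmbedding.trans v, ?_⟩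
    intro x y hxy
    obtain ⟨a, b, hab, rfl, rfl⟩ := (SimpleGraph.map_adj _ _ _ _).1 hxy
    have := hE hab
    simpa [hH] using this)
  have h2 := aux_emb_bound k H q hq hf
  set Em := #{φ : Equiv.Perm (Fin (k+1)) | ∀ i : Fin k,
        H.Adj (φ ⟨q i, by have := hq i; omega⟩) (φ i.succ)} with hEm
  set e := #H.edgeFinset with hedef
  have h3 : ((k+1).factorial : ℝ) * 2 ^ (e - k) ≤ Em * ((k+1).factorial * c ^ (k+1)) := by
    have : (((k+1).factorial * 2 ^ (e - k) : ℕ) : ℝ) ≤ ((Em * (𝒳 (k+1)).ncard : ℕ) : ℝ) := by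
      exact_mod_cast h1
    push_cast at this
    refine this.trans ?_
    gcongr
    exact hX (k+1)
  have hfac : (0:ℝ) < (k+1).factorial := by exact_mod_cast Nat.factorial_pos _
  have h4 : (2:ℝ) ^ (e - k) ≤ Em * c ^ (k+1) := by
    have : ((k+1).factorial : ℝ) * 2 ^ (e - k) ≤ (k+1).factorial * (Em * c ^ (k+1)) := by
      linarith
    exact le_of_mul_le_mul_left this hfac
  have h5 : (2:ℝ) ^ e ≤ 2 ^ (k+1) * (Em * c ^ (k+1)) := by
    calc (2:ℝ) ^ e ≤ 2 ^ ((k+1) + (e - k)) := by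
          apply pow_le_pow_right₀ (by norm_num); omega
      _ = 2 ^ (k+1) * 2 ^ (e-k) := by rw [pow_add]
      _ ≤ _ := by gcongr
  have h6 : ∏ v, ((H.degree v : ℝ) + 1) ^ 2 ≤ 1024 ^ (k+1) * (4/3 : ℝ) ^ e := by
    calc ∏ v, ((H.degree v : ℝ) + 1) ^ 2 ≤ ∏ v, (1024 * ((33/32 : ℝ)^2) ^ (H.degree v)) := by
          apply Finset.prod_le_prod (fun _ _ => by positivity)
          intro x _
          have hb := one_add_mul_le_pow (show (-2:ℝ) ≤ 1/32 by norm_num) (H.degree x)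
          have hb' : (H.degree x : ℝ) + 1 ≤ 32 * (33/32 : ℝ) ^ (H.degree x) := by
            norm_num at hb ⊢
            have : (0:ℝ) ≤ H.degree x := by positivity
            linarith
          calc ((H.degree x : ℝ) + 1)^2 ≤ (32 * (33/32 : ℝ) ^ (H.degree x))^2 := by gcongr
            _ = _ := by rw [mul_pow, ← pow_mul, ← pow_mul, mul_comm (H.degree x)]; norm_num
      _ = 1024 ^ (k+1) * ((33/32 : ℝ)^2) ^ (2 * e) := by
          rw [Finset.prod_mul_distrib, Finset.prod_const, Finset.prod_pow_eq_pow_sum,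
            H.sum_degrees_eq_twice_card_edges, Finset.card_univ, Fintype.card_fin]
      _ ≤ _ := by
          rw [pow_mul]
          gcongr
          norm_num
  have h7 : ((k:ℝ)+1) ≤ 2 ^ (k+1) := by
    exact_mod_cast (Nat.lt_two_pow_self (n := k+1)).le
  have h8 : (2:ℝ)^e ≤ (4096 * c) ^ (k+1) * (4/3 : ℝ)^e := by
    calc (2:ℝ)^e ≤ 2 ^ (k+1) * (Em * c ^ (k+1)) := h5
      _ ≤ 2 ^ (k+1) * ((2 ^ (k+1) * (1024 ^ (k+1) * (4/3 : ℝ) ^ e)) * c ^ (k+1)) := by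
          gcongr
          exact h2.trans (mul_le_mul h7 (le_trans (le_of_eq (by congr!)) h6) (by positivity) (by positivity))
      _ = _ := by
          rw [show (4096 * c : ℝ) = 2 * 2 * 1024 * c by ring]
          simp only [mul_pow]; ring
  have h9 : (3/2:ℝ)^e ≤ (4096 * c)^(k+1) := by
    have : (2:ℝ)^e = (3/2)^e * (4/3)^e := by rw [← mul_pow]; norm_num
    rw [this] at h8
    exact le_of_mul_le_mul_right h8 (by positivity)
  have h10 : (4096*c)^(k+1) < (3/2:ℝ)^e := by
    calc (4096*c)^(k+1) < ((3/2:ℝ)^m)^(k+1) := by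
          apply pow_lt_pow_left₀ hm (by positivity) (by omega)
      _ = (3/2:ℝ)^(m*(k+1)) := by rw [pow_mul]
      _ ≤ _ := by
          apply pow_le_pow_right₀ (by norm_num)
          have : 4 * m * (k+1) = 4 * (m * (k+1)) := by ring
          omega
  linarith

open Classical in
theorem aux_orient {N d : ℕ} (G : SimpleGraph (Fin N))
    (h : ∀ S : Finset (Fin N), S.Nonempty → ∃ v ∈ S, #{u ∈ S | G.Adj v u} < d) :
    ∃ M : Fin N → Finset (Fin N), (∀ v, #(M v) ≤ d) ∧
      ∀ u v, G.Adj u v ↔ v ∈ M u ∨ u ∈ M v := by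
  suffices hS : ∀ S : Finset (Fin N), ∃ M : Fin N → Finset (Fin N), (∀ v, #(M v) ≤ d) ∧
      (∀ v, ∀ u ∈ M v, G.Adj v u) ∧
      ∀ u ∈ S, ∀ v ∈ S, G.Adj u v → v ∈ M u ∨ u ∈ M v by
    obtain ⟨M, h1, h2, h3⟩ := hS Finset.univ
    refine ⟨M, h1, fun u v => ⟨h3 u (by simp) v (by simp), ?_⟩⟩
    rintro (h | h)
    · exact h2 _ _ h
    · exact (h2 _ _ h).symm
  intro S
  induction S using Finset.strongInduction with
  | H S ih =>
    rcases S.eq_empty_or_nonempty with rfl | hne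
    · exact ⟨fun _ => ∅, by simp, by simp, by simp⟩
    · obtain ⟨w, hw, hlt⟩ := h S hne
      obtain ⟨M, h1, h2, h3⟩ := ih (S.erase w) (Finset.erase_ssubset hw)
      refine ⟨Function.update M w {u ∈ S | G.Adj w u}, ?_, ?_, ?_⟩
      · intro v
        by_cases hv : v = w
        · subst hv; simpa using hlt.le
        · rw [Function.update_of_ne hv]; exact h1 v
      · intro v u
        by_cases hv : v = w
        · subst hv; simp
        · rw [Function.update_of_ne hv]; exact h2 v u
      · intro u hu v hv huv
        by_cases h4 : u = w
        · subst h4; left; simp [hv, huv]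
        · by_cases h5 : v = w
          · subst h5; right; simp [hu, huv.symm]
          · rw [Function.update_of_ne h4, Function.update_of_ne h5]
            exact h3 u (by simp [h4, hu]) v (by simp [h5, hv]) huv

end helpers

/-- Every monotone small class admits an implicit representation:
if `𝒳` is monotone and `|𝒳ₙ| ≤ n! * cⁿ` for all `n` for some constant `c > 0`, then
there is a constant `C` such that `𝒳` admits a `C * ⌈log₂ n⌉`-bit adjacency labeling
scheme. -/
theorem monotone_small_implicit_representation (𝒳 : GraphClass)
    (hmono : MonotoneGraphClass 𝒳)
    (hsmall : ∃ c : ℝ, 0 < c ∧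
      ∀ n : ℕ, ((𝒳 n).ncard : ℝ) ≤ (n.factorial : ℝ) * c ^ n) :
    ∃ C : ℕ, HasScheme 𝒳 (fun n => C * Nat.clog 2 n) := by
  classical
  obtain ⟨d, hd⟩ := aux_degenerate 𝒳 hmono hsmall
  let R : List Bool → List Bool → Prop := fun x y =>
    ∃ i < d, ∀ j < x.length / (d+1), x[(i+1) * (x.length / (d+1)) + j]? = y[j]?
  refine ⟨d+1, fun x y => decide (R x y ∨ R y x), ?_⟩
  intro n G hG
  obtain ⟨M, hM, hadj⟩ := aux_orient G (fun S hS => by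
    obtain ⟨v, hv, hlt⟩ := hd n G hG S hS
    exact ⟨v, hv, by convert hlt⟩)
  set L := Nat.clog 2 n with hL
  obtain ⟨id⟩ : Nonempty (Fin n ↪ (Fin L → Bool)) := by
    apply Function.Embedding.nonempty_of_card_le
    simpa using Nat.le_pow_clog (by norm_num) n
  -- block number `i` of the label of `v`
  let w : Fin n → ℕ → Fin n := fun v i => if i = 0 then v else (M v).toList.getD (i-1) v
  let ℓ : Fin n → List Bool := fun v => List.ofFn (n := (d+1) * L) fun t =>
    id (w v (t / L)) ⟨t % L, Nat.mod_lt _ (Nat.pos_of_ne_zero fun h => by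
      have := t.2; simp [h] at this)⟩
  have hlen : ∀ v, (ℓ v).length = (d+1) * L := fun v => by simp [ℓ]
  refine ⟨ℓ, hlen, ?_⟩
  have hget : ∀ v i j, i < d + 1 → ∀ hj : j < L, (ℓ v)[i * L + j]? = some (id (w v i) ⟨j, hj⟩) := by
    intro v i j hi hj
    have hlt : i * L + j < (d+1) * L := by
      calc i * L + j < i * L + L := by omega
        _ = (i+1) * L := by ring
        _ ≤ _ := Nat.mul_le_mul_right _ (by omega)
    have hdiv : (i * L + j) / L = i := by
      rw [mul_comm, Nat.mul_add_div (by omega), Nat.div_eq_of_lt hj, add_zero]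
    have hmod : (i * L + j) % L = j := by
      rw [mul_comm, Nat.mul_add_mod, Nat.mod_eq_of_lt hj]
    simp only [ℓ, List.getElem?_ofFn, hlt, dif_pos, hdiv, hmod]
  have hR : ∀ u v, u ≠ v → (R (ℓ u) (ℓ v) ↔ v ∈ M u) := by
    intro u v huv
    have hq : (d+1) * L / (d+1) = L := Nat.mul_div_cancel_left _ (by omega)
    simp only [R, hlen, hq]
    have hblock : ∀ i < d, (∀ j < L, (ℓ u)[(i+1) * L + j]? = (ℓ v)[j]?) ↔ w u (i+1) = v := by
      intro i hi
      constructor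
      · intro h
        apply id.injective
        funext ⟨j, hj⟩
        have h1 := h j hj
        have h2 := hget v 0 j (by omega) hj
        rw [zero_mul, zero_add] at h2
        rw [hget u (i+1) j (by omega) hj, h2] at h1
        simpa [w] using h1
      · intro h j hj
        have h2 := hget v 0 j (by omega) hj
        rw [zero_mul, zero_add] at h2
        rw [hget u (i+1) j (by omega) hj, h2, h]
        simp [w]
    constructor
    · rintro ⟨i, hi, h⟩
      have h1 := (hblock i hi).1 h
      simp only [w, Nat.add_eq_zero_iff, one_ne_zero, and_false, if_false, Nat.add_sub_cancel] at h1
      rw [List.getD_eq_getElem?_getD] at h1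
      by_cases hlt : i < (M u).toList.length
      · rw [List.getElem?_eq_getElem hlt, Option.getD_some] at h1
        rw [← h1, ← Finset.mem_toList]
        exact List.getElem_mem hlt
      · rw [List.getElem?_eq_none (by omega), Option.getD_none] at h1
        exact absurd h1 huv
    · intro hv
      rw [← Finset.mem_toList] at hv
      obtain ⟨i, hi, hiv⟩ := List.getElem_of_mem hv
      have hid : i < d := by
        have := hM u
        rw [Finset.length_toList] at hi
        omega
      refine ⟨i, hid, (hblock i hid).2 ?_⟩
      simp [w, List.getD_eq_getElem?_getD, List.getElem?_eq_getElem hi, hiv]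
  intro u v huv
  rw [decide_eq_true_iff, hR u v huv, hR v u huv.symm, hadj]
end

section
/- Let G be a finite simple graph of minimum degree d ≥ 1. Then G has an induced subgraph H of minimum degree at least d such that H has a spanning tree of maximum degree at most d. -/
/-- Every graph of minimum degree `d ≥ 1` has an induced subgraph `H`
of minimum degree at least `d` such that `H` has a spanning tree of maximum degree at
most `d`. -/
theorem exists_induced_minDegree_spanning_tree {V : Type*} [Fintype V] [Nonempty V]
    (G : SimpleGraph V) (d : ℕ) (hd : 1 ≤ d)
    (hmin : ∀ v : V, d ≤ (G.neighborSet v).ncard) :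
    ∃ (A : Set V) (T : SimpleGraph A),
      (∀ v : A, d ≤ ((G.induce A).neighborSet v).ncard) ∧
      T ≤ G.induce A ∧ T.IsTree ∧
      ∀ v : A, (T.neighborSet v).ncard ≤ d := by
  classical
  -- a minimal nonempty set inducing minimum degree at least `d`
  obtain ⟨A, ⟨⟨a, ha⟩, hA⟩, hAmin⟩ := (Set.toFinite {A : Set V | A.Nonempty ∧
      ∀ v ∈ A, d ≤ {x | G.Adj v x ∧ x ∈ A}.ncard}).exists_minimal
    ⟨Set.univ, Set.univ_nonempty, fun v _ => by
      simpa [SimpleGraph.neighborSet] using hmin v⟩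
  -- proper nonempty subsets have a vertex of small degree
  have key : ∀ C : Set V, C ⊆ A → C ≠ A → C.Nonempty →
      ∃ w ∈ C, {x | G.Adj w x ∧ x ∈ C}.ncard < d := by
    intro C hCA hne hC
    by_contra! hcon
    exact hne (hCA.antisymm (hAmin ⟨hC, hcon⟩ hCA))
  -- a vertex of degree at most `d`
  have hv : ∃ v ∈ A, {x | G.Adj v x ∧ x ∈ A}.ncard ≤ d := by
    by_contra! hcon
    have hnb : {x | G.Adj a x ∧ x ∈ A}.Nonempty := by
      rw [← Set.ncard_pos]
      have := hcon a ha
      omega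
    obtain ⟨b, hab, hb⟩ := hnb
    obtain ⟨w, hw, hlt⟩ := key (A \ {a}) Set.diff_subset
      (fun h => by rw [← h] at ha; exact ha.2 rfl) ⟨b, hb, fun h => hab.ne h.symm⟩
    have h1 := hcon w hw.1
    have h2 : {x | G.Adj w x ∧ x ∈ A} ⊆ insert a {x | G.Adj w x ∧ x ∈ A \ {a}} := by
      rintro x ⟨hx, hxA⟩
      by_cases hxa : x = a
      · exact Or.inl hxa
      · exact Or.inr ⟨hx, hxA, hxa⟩
    have h3 := (Set.ncard_le_ncard h2).trans (Set.ncard_insert_le _ _)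
    omega
  obtain ⟨r, hr, hrd⟩ := hv
  -- grow a connected subgraph from `r`
  obtain ⟨B, ⟨hBA, hrB, S, hSG, hSB, hreach, hdeg⟩, hBmax⟩ := (Set.toFinite {B : Set V | B ⊆ A ∧
      r ∈ B ∧ ∃ S : SimpleGraph V, S ≤ G ∧ (∀ x y, S.Adj x y → y ∈ B) ∧
        (∀ x ∈ B, S.Reachable r x) ∧
        ∀ x ∈ B, {y | S.Adj x y ∨ (G.Adj x y ∧ y ∈ A \ B)}.ncard ≤ d}).exists_maximal
    ⟨{r}, by simpa using hr, rfl, ⊥, bot_le, by simp, by simp, by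
      rintro x rfl
      refine (Set.ncard_le_ncard ?_).trans hrd
      rintro y (h | h)
      · exact h.elim
      · exact ⟨h.1, h.2.1⟩⟩
  have hBeq : B = A := by
    by_contra hne
    obtain ⟨w, ⟨hwA, hwB⟩, hwd⟩ := key (A \ B) Set.diff_subset
      (fun h => by rw [← h] at hr; exact hr.2 hrB)
      (Set.nonempty_of_ssubset (hBA.ssubset_of_ne hne))
    have hu : ∃ u ∈ B, G.Adj u w := by
      by_contra! hcon
      have h1 := hA w hwA
      have h2 : {x | G.Adj w x ∧ x ∈ A} ⊆ {x | G.Adj w x ∧ x ∈ A \ B} := by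
        rintro x ⟨hx, hxA⟩
        exact ⟨hx, hxA, fun hxB => hcon x hxB hx.symm⟩
      have := Set.ncard_le_ncard h2
      omega
    obtain ⟨u, huB, huw⟩ := hu
    have hadj : ∀ x y, (S ⊔ SimpleGraph.edge u w).Adj x y ↔
        S.Adj x y ∨ (x = u ∧ y = w) ∨ (x = w ∧ y = u) := by
      intro x y
      rw [SimpleGraph.sup_adj, SimpleGraph.edge_adj]
      have := huw.ne
      grind
    refine hwB (hBmax (y := insert w B) ⟨Set.insert_subset hwA hBA, Or.inr hrB,
      S ⊔ SimpleGraph.edge u w, ?_, ?_, ?_, ?_⟩ (Set.subset_insert _ _) (Or.inl rfl))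
    · intro x y h
      rcases (hadj x y).1 h with h | ⟨rfl, rfl⟩ | ⟨rfl, rfl⟩
      · exact hSG h
      · exact huw
      · exact huw.symm
    · intro x y h
      rcases (hadj x y).1 h with h | ⟨rfl, rfl⟩ | ⟨rfl, rfl⟩
      · exact Or.inr (hSB _ _ h)
      · exact Or.inl rfl
      · exact Or.inr huB
    · have hmono : ∀ x ∈ B, (S ⊔ SimpleGraph.edge u w).Reachable r x :=
        fun x hx => (hreach x hx).mono le_sup_left
      rintro x (rfl | hx)
      · exact (hmono u huB).trans ((hadj u x).2 (Or.inr (Or.inl ⟨rfl, rfl⟩))).reachable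
      · exact hmono x hx
    · rintro x (rfl | hx)
      · have h2 : {y | (S ⊔ SimpleGraph.edge u x).Adj x y ∨ (G.Adj x y ∧ y ∈ A \ insert x B)} ⊆
            insert u {y | G.Adj x y ∧ y ∈ A \ B} := by
          rintro y (h | ⟨h, hyA, hyB⟩)
          · rcases (hadj x y).1 h with h | ⟨rfl, rfl⟩ | ⟨_, rfl⟩
            · exact (hwB (hSB _ _ h.symm)).elim
            · exact (hwB huB).elim
            · exact Or.inl rfl
          · exact Or.inr ⟨h, hyA, fun h => hyB (Or.inr h)⟩
        have h3 := (Set.ncard_le_ncard h2).trans (Set.ncard_insert_le _ _)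
        omega
      · refine (Set.ncard_le_ncard ?_).trans (hdeg x hx)
        rintro y (h | ⟨h, hyA, hyB⟩)
        · rcases (hadj x y).1 h with h | ⟨rfl, rfl⟩ | ⟨rfl, rfl⟩
          · exact Or.inl h
          · exact Or.inr ⟨huw, hwA, hwB⟩
          · exact (hwB hx).elim
        · exact Or.inr ⟨h, hyA, fun h => hyB (Or.inr h)⟩
  subst hBeq
  have hreach' : ∀ x, S.Reachable r x →
      ∃ hx : x ∈ B, (S.induce B).Reachable ⟨r, hr⟩ ⟨x, hx⟩ := by
    intro x hx
    rw [SimpleGraph.reachable_iff_reflTransGen] at hx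
    induction hx with
    | refl => exact ⟨hr, SimpleGraph.Reachable.refl _⟩
    | tail _ h ih =>
      obtain ⟨h1, h2⟩ := ih
      refine ⟨hSB _ _ h, h2.trans (SimpleGraph.Adj.reachable ?_)⟩
      exact h
  have hconn : (S.induce B).Connected := by
    rw [SimpleGraph.connected_iff_exists_forall_reachable]
    exact ⟨⟨r, hr⟩, fun x => (hreach' x (hreach x x.2)).2⟩
  obtain ⟨T, hTS, hT⟩ := hconn.exists_isTree_le
  refine ⟨B, T, ?_, ?_, hT, ?_⟩
  · intro v
    refine (hA v v.2).trans ?_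
    rw [← Set.ncard_image_of_injective ((G.induce B).neighborSet v) Subtype.val_injective]
    refine Set.ncard_le_ncard ?_
    rintro x ⟨hx, hxB⟩
    exact ⟨⟨x, hxB⟩, hx, rfl⟩
  · intro x y h
    exact hSG (hTS h)
  · intro v
    refine le_trans ?_ (hdeg v v.2)
    rw [← Set.ncard_image_of_injective (T.neighborSet v) Subtype.val_injective]
    refine Set.ncard_le_ncard ?_
    rintro _ ⟨x, hx, rfl⟩
    exact Or.inl (hTS hx)
end

section
/- Let G be a connected graph on n vertices with m edges, minimum degree d ≥ 1000, and possessing a spanning tree of maximum degree at most d. Then G contains at least 2^{4m/5} pairwise non-isomorphic spanning connected subgraphs F, each satisfying aut(F) ≤ 2^{m/10}, where aut(F) denotes the number of automorphisms of F. -/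
open Classical in
theorem aux_sum_update {V : Type*} [Fintype V] (v : V) (H : (V → V) → ℝ) :
    ∑ φ : V → V, ∑ x : V, H (Function.update φ v x) = Fintype.card V * ∑ φ : V → V, H φ := by
  rw [← Fintype.sum_prod_type' (f := fun (φ : V → V) (x : V) => H (Function.update φ v x))]
  let e : (V → V) × V ≃ (V → V) × V :=
    { toFun := fun q => (Function.update q.1 v q.2, q.1 v)
      invFun := fun q => (Function.update q.1 v q.2, q.1 v)
      left_inv := fun q => by ext <;> simp
      right_inv := fun q => by ext <;> simp }
  rw [Fintype.sum_equiv e (fun q => H (Function.update q.1 v q.2)) (fun q => H q.1)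
    (fun q => rfl)]
  rw [Fintype.sum_prod_type' (f := fun (φ : V → V) (x : V) => H φ)]
  simp [Finset.mul_sum]

open Classical in
theorem aux_weight_sum {V : Type*} [Fintype V] (G : SimpleGraph V) (r : V) (p : V → V)
    (ρ : V → ℕ) (hρ : ∀ v, v ≠ r → ρ (p v) < ρ v) (hdeg : ∀ v, 0 < G.degree v)
    (S : Finset V) : r ∉ S →
    (Fintype.card V : ℝ) ^ S.card * ∑ φ : V → V, ∏ v ∈ S,
      (if G.Adj (φ (p v)) (φ v) then (1 : ℝ) / G.degree (φ (p v)) else 0)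
      = (Fintype.card V : ℝ) ^ Fintype.card V := by
  induction S using Finset.induction_on_max_value ρ with
  | empty => intro _; simp
  | insert a s ha hmax ih =>
    intro hr
    have hra : a ≠ r := by rintro rfl; simp at hr
    have hrs : r ∉ s := fun h => hr (by simp [h])
    rw [← ih hrs, Finset.card_insert_of_notMem ha, pow_succ, mul_assoc, ← aux_sum_update a]
    congr 1
    apply Finset.sum_congr rfl
    intro φ _
    have hpa : p a ≠ a := fun h => by have := hρ a hra; rw [h] at this; omega
    have key : ∀ x, ∏ v ∈ insert a s, (if G.Adj (Function.update φ a x (p v))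
          (Function.update φ a x v) then (1 : ℝ) / G.degree (Function.update φ a x (p v)) else 0)
        = (if G.Adj (φ (p a)) x then (1 : ℝ) / G.degree (φ (p a)) else 0) *
          ∏ v ∈ s, (if G.Adj (φ (p v)) (φ v) then (1 : ℝ) / G.degree (φ (p v)) else 0) := by
      intro x
      rw [Finset.prod_insert ha]
      congr 1
      · rw [Function.update_self, Function.update_of_ne hpa]
      · apply Finset.prod_congr rfl
        intro v hv
        have h1 : v ≠ a := fun h => ha (h ▸ hv)
        have h2 : p v ≠ a := by
          intro h
          have := hρ v (fun h => hrs (h ▸ hv))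
          have := hmax v hv
          rw [h] at *
          omega
        rw [Function.update_of_ne h1, Function.update_of_ne h2]
    simp_rw [key]
    rw [← Finset.sum_mul]
    have : ∑ x, (if G.Adj (φ (p a)) x then (1 : ℝ) / G.degree (φ (p a)) else 0) = 1 := by
      rw [← Finset.sum_filter, Finset.sum_const, ← G.neighborFinset_eq_filter,
        G.card_neighborFinset_eq_degree, nsmul_eq_mul]
      have := hdeg (φ (p a))
      field_simp
    rw [this, one_mul]

theorem aux_log (d D : ℝ) (hd : 1000 ≤ d) (hD : 0 < D) :
    Real.log D / Real.log 2 ≤ 0.026 * d + 0.001 * D / d := by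
  have hl : (0.6931471803 : ℝ) < Real.log 2 := Real.log_two_gt_d9
  set s := Real.sqrt (D / 2 ^ 25) with hs
  have hs0 : 0 < s := Real.sqrt_pos.2 (by positivity)
  have hs2 : D = 2 ^ 25 * s ^ 2 := by
    rw [hs, Real.sq_sqrt (by positivity)]; ring
  have h1 : Real.log D = 25 * Real.log 2 + 2 * Real.log s := by
    rw [hs2, Real.log_mul (by positivity) (by positivity), Real.log_pow, Real.log_pow]
    norm_num
  have h2 := Real.log_le_sub_one_of_pos hs0
  have h3 : Real.log D / Real.log 2 ≤ 25 + 3 * s := by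
    rw [div_le_iff₀ (by linarith), h1]
    nlinarith
  have h4 : 3 * s ≤ 0.001 * d + 0.001 * D / d := by
    have : 0.001 * d + 0.001 * D / d = (0.001 * d * d + 0.001 * D) / d := by field_simp
    rw [this, le_div_iff₀ (by linarith), hs2]
    nlinarith [sq_nonneg (d - 1500 * s), sq_nonneg s]
  linarith

open Classical in
theorem aux_count_s7 {V : Type*} [Fintype V] (G T : SimpleGraph V) (d : ℕ) (hd : 1000 ≤ d)
    (hmin : ∀ v, d ≤ G.degree v) (hT : T.Connected) (hTd : ∀ v, T.degree v ≤ d) :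
    ((Finset.univ.filter (fun φ : Equiv.Perm V => ∀ u v, T.Adj u v → G.Adj (φ u) (φ v))).card : ℝ)
      ≤ (2 : ℝ) ^ ((G.edgeFinset.card : ℝ) / 10) := by
  obtain ⟨r⟩ := hT.nonempty
  have hpar : ∀ v, ∃ u, v ≠ r → (T.Adj u v ∧ T.dist u r < T.dist v r) := by
    intro v
    by_cases hv : v = r
    · exact ⟨v, fun h => absurd hv h⟩
    obtain ⟨w, hw⟩ := (hT v r).exists_walk_length_eq_dist
    cases w with
    | nil => exact absurd rfl hv
    | cons h q =>
      refine ⟨_, fun _ => ⟨h.symm, ?_⟩⟩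
      rw [← hw, SimpleGraph.Walk.length_cons]
      exact Nat.lt_succ_of_le (SimpleGraph.dist_le q)
  choose p hp using hpar
  set N := Fintype.card V with hN
  set m := G.edgeFinset.card with hm
  have hNpos : 0 < N := Fintype.card_pos_iff.2 ⟨r⟩
  have hsumdeg : ∑ v, (G.degree v : ℝ) = 2 * m := by
    exact_mod_cast G.sum_degrees_eq_twice_card_edges
  have hNd : (N : ℝ) * d ≤ 2 * m := by
    rw [← hsumdeg]
    calc (N : ℝ) * d = ∑ v : V, (d : ℝ) := by simp [hN]
      _ ≤ _ := Finset.sum_le_sum (fun v _ => by exact_mod_cast hmin v)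
  have hd' : (1000 : ℝ) ≤ d := by exact_mod_cast hd
  have hdpos : (0 : ℝ) < d := by linarith
  have hDpos : ∀ v, 0 < G.degree v := fun v => by have := hmin v; omega
  set S : Finset V := Finset.univ.erase r with hS
  have hScard : S.card = N - 1 := by simp [hS, hN, Finset.card_univ]
  have hW := aux_weight_sum G r p (fun v => T.dist v r) (fun v hv => (hp v hv).2) hDpos S
    (by simp [hS])
  set W : (V → V) → ℝ := fun φ => ∏ v ∈ S,
      (if G.Adj (φ (p v)) (φ v) then (1 : ℝ) / G.degree (φ (p v)) else 0) with hWdef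
  have hW' : ∑ φ, W φ = N := by
    rw [hScard] at hW
    have h1 : (N : ℝ) ^ N = (N : ℝ) ^ (N - 1) * N := by
      rw [← pow_succ, Nat.sub_add_cancel hNpos]
    rw [h1] at hW
    exact mul_left_cancel₀ (by positivity) hW
  have hW0 : ∀ φ, 0 ≤ W φ := fun φ => Finset.prod_nonneg (fun v _ => by split_ifs <;> positivity)
  set E := Finset.univ.filter
    (fun φ : Equiv.Perm V => ∀ u v, T.Adj u v → G.Adj (φ u) (φ v)) with hE
  have hlow : ∀ φ ∈ E, (2 : ℝ) ^ (-(0.054 * (m : ℝ))) ≤ W φ := by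
    intro φ hφ
    have hφ' : ∀ u v, T.Adj u v → G.Adj (φ u) (φ v) := by simpa [hE] using hφ
    set f : V → ℝ := fun u => -(0.026 * d + 0.001 * (G.degree (φ u) : ℝ) / d) with hf
    have hfac : ∏ v ∈ S, (2 : ℝ) ^ (f (p v)) ≤ W φ := by
      apply Finset.prod_le_prod
      · intro v _; positivity
      · intro v hv
        have hvr : v ≠ r := by simpa [hS] using hv
        rw [if_pos (hφ' _ _ (hp v hvr).1)]
        have hpos : (0 : ℝ) < G.degree (φ (p v)) := by exact_mod_cast hDpos _
        rw [hf]
        simp only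
        rw [Real.rpow_neg (by norm_num), ← one_div]
        apply one_div_le_one_div_of_le hpos
        have := aux_log d _ hd' hpos
        rw [Real.le_rpow_iff_log_le hpos (by norm_num)]
        rwa [div_le_iff₀ (Real.log_pos (by norm_num))] at this
    refine le_trans ?_ hfac
    rw [← Real.rpow_sum_of_pos (by norm_num : (0 : ℝ) < 2)]
    apply Real.rpow_le_rpow_of_exponent_le (by norm_num)
    have h1 : ∑ v ∈ S, (G.degree (φ (p v)) : ℝ) ≤ d * (2 * m) := by
      rw [← hsumdeg, ← Equiv.sum_comp φ (fun u => (G.degree u : ℝ)), Finset.mul_sum,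
        ← Finset.sum_fiberwise S p]
      apply Finset.sum_le_sum
      intro u _
      have h2 : ∑ v ∈ S with p v = u, (G.degree (φ (p v)) : ℝ)
          = ∑ v ∈ S with p v = u, (G.degree (φ u) : ℝ) := by
        apply Finset.sum_congr rfl
        intro v hv
        rw [(Finset.mem_filter.1 hv).2]
      rw [h2, Finset.sum_const, nsmul_eq_mul]
      apply mul_le_mul_of_nonneg_right _ (by positivity)
      have h3 : (S.filter (fun v => p v = u)).card ≤ T.degree u := by
        rw [← SimpleGraph.card_neighborFinset_eq_degree]
        apply Finset.card_le_card
        intro v hv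
        rw [Finset.mem_filter] at hv
        have hvr : v ≠ r := by simpa [hS] using hv.1
        rw [SimpleGraph.mem_neighborFinset, ← hv.2]
        exact (hp v hvr).1
      exact_mod_cast h3.trans (hTd u)
    have h4 : ∑ v ∈ S, f (p v) = -((S.card : ℝ) * (0.026 * d)
        + 0.001 / d * ∑ v ∈ S, (G.degree (φ (p v)) : ℝ)) := by
      simp only [hf]
      rw [Finset.sum_neg_distrib, Finset.sum_add_distrib, Finset.mul_sum, Finset.sum_const,
        nsmul_eq_mul]
      congr 2
      apply Finset.sum_congr rfl
      intro v _
      ring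
    rw [h4]
    have h5 : (S.card : ℝ) ≤ N := by exact_mod_cast (by omega : S.card ≤ N)
    have h6 : 0.001 / d * ∑ v ∈ S, (G.degree (φ (p v)) : ℝ) ≤ 0.002 * m := by
      calc _ ≤ 0.001 / d * (d * (2 * (m : ℝ))) := by gcongr
        _ = _ := by field_simp; ring
    have h7 : (S.card : ℝ) * (0.026 * d) ≤ 0.052 * m := by
      have : (S.card : ℝ) * (0.026 * d) ≤ N * (0.026 * d) := by gcongr
      linarith
    linarith
  have hmain : (E.card : ℝ) * (2 : ℝ) ^ (-(0.054 * (m : ℝ))) ≤ N := by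
    rw [← hW', ← nsmul_eq_mul]
    calc E.card • (2 : ℝ) ^ (-(0.054 * (m : ℝ))) ≤ ∑ φ ∈ E, W φ :=
          Finset.card_nsmul_le_sum _ _ _ hlow
      _ = ∑ ψ ∈ E.map ⟨fun φ : Equiv.Perm V => (φ : V → V), DFunLike.coe_injective⟩, W ψ := by
          rw [Finset.sum_map]; rfl
      _ ≤ _ := Finset.sum_le_sum_of_subset_of_nonneg (Finset.subset_univ _) (fun ψ _ _ => hW0 ψ)
  have hN2 : (N : ℝ) ≤ 2 ^ (N : ℝ) := by
    rw [Real.rpow_natCast]; exact_mod_cast Nat.lt_two_pow_self.le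
  have hNm : (N : ℝ) ≤ 0.002 * m := by
    have : (N : ℝ) * 1000 ≤ N * d := by gcongr
    linarith
  rw [Real.rpow_neg (by norm_num), ← div_eq_mul_inv, div_le_iff₀ (by positivity)] at hmain
  calc (E.card : ℝ) ≤ N * 2 ^ (0.054 * (m : ℝ)) := hmain
    _ ≤ 2 ^ (N : ℝ) * 2 ^ (0.054 * (m : ℝ)) := by gcongr
    _ = 2 ^ ((N : ℝ) + 0.054 * m) := by rw [Real.rpow_add (by norm_num)]
    _ ≤ _ := by
      apply Real.rpow_le_rpow_of_exponent_le (by norm_num)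
      have : (0 : ℝ) ≤ m := by positivity
      linarith

open Classical in
theorem aux_interval {V : Type*} [Fintype V] (G T : SimpleGraph V) (hTG : T ≤ G) :
    2 ^ (G.edgeFinset.card - T.edgeFinset.card) ≤
      (Finset.univ.filter (fun F : SimpleGraph V => T ≤ F ∧ F ≤ G)).card := by
  have hsub : T.edgeFinset ⊆ G.edgeFinset := SimpleGraph.edgeFinset_mono hTG
  rw [← Finset.card_sdiff_of_subset hsub, ← Finset.card_powerset]
  apply Finset.card_le_card_of_injOn
    (fun A : Finset (Sym2 V) => T ⊔ SimpleGraph.fromEdgeSet (A : Set (Sym2 V)))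
  · intro A hA
    have hA' : A ⊆ G.edgeFinset \ T.edgeFinset := Finset.mem_powerset.1 hA
    simp only [Finset.coe_filter, Finset.mem_univ, true_and, Set.mem_ofPred_eq]
    refine ⟨le_sup_left, sup_le hTG ?_⟩
    intro u v huv
    rw [SimpleGraph.fromEdgeSet_adj] at huv
    have := hA' huv.1
    simp at this
    exact this.1
  · have key : ∀ A : Finset (Sym2 V), A ⊆ G.edgeFinset \ T.edgeFinset →
        (A : Set (Sym2 V)) =
          (T ⊔ SimpleGraph.fromEdgeSet (A : Set (Sym2 V))).edgeSet \ T.edgeSet := by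
      intro A hA
      ext e
      induction e using Sym2.ind with
      | _ u v =>
        simp only [Finset.mem_coe, Set.mem_sdiff, SimpleGraph.mem_edgeSet, SimpleGraph.sup_adj,
          SimpleGraph.fromEdgeSet_adj]
        constructor
        · intro h
          have := hA h
          simp at this
          exact ⟨Or.inr ⟨h, this.1.ne⟩, this.2⟩
        · rintro ⟨h | h, h'⟩
          · exact absurd h h'
          · exact h.1
    intro A hA B hB hAB
    have hA' : A ⊆ G.edgeFinset \ T.edgeFinset := Finset.mem_powerset.1 hA
    have hB' : B ⊆ G.edgeFinset \ T.edgeFinset := Finset.mem_powerset.1 hB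
    simp only at hAB
    have h1 := key A hA'
    rw [hAB, ← key B hB'] at h1
    exact_mod_cast h1

/-- Let `G` be a connected graph on `n` vertices with `m` edges, minimum
degree `d ≥ 1000`, having a spanning tree of maximum degree at most `d`. Then `G` contains
at least `2 ^ (4 * m / 5)` pairwise non-isomorphic spanning connected subgraphs `F`, each
with at most `2 ^ (m / 10)` automorphisms. -/
theorem many_nonisomorphic_spanning_subgraphs {V : Type*} [Fintype V]
    (G : SimpleGraph V) (n m d : ℕ)
    (hn : Fintype.card V = n) (hm : G.edgeSet.ncard = m)
    (hconn : G.Connected) (hd : 1000 ≤ d)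
    (hmin : ∀ v : V, d ≤ (G.neighborSet v).ncard)
    (htree : ∃ T : SimpleGraph V, T ≤ G ∧ T.IsTree ∧
      ∀ v : V, (T.neighborSet v).ncard ≤ d) :
    ∃ S : Finset (SimpleGraph V),
      (2 : ℝ) ^ (4 * (m : ℝ) / 5) ≤ (S.card : ℝ) ∧
      (∀ F ∈ S, F ≤ G ∧ F.Connected ∧
        (Nat.card (F ≃g F) : ℝ) ≤ (2 : ℝ) ^ ((m : ℝ) / 10)) ∧
      (∀ F ∈ S, ∀ F' ∈ S, F ≠ F' → IsEmpty (F ≃g F')) := by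
  classical
  obtain ⟨T, hTG, hT, hTd⟩ := htree
  have hmin' : ∀ v, d ≤ G.degree v := fun v => by
    have := hmin v
    rw [Set.ncard_eq_toFinset_card'] at this
    exact this
  have hTd' : ∀ v, T.degree v ≤ d := fun v => by
    have := hTd v
    rw [Set.ncard_eq_toFinset_card'] at this
    exact this
  have hm' : G.edgeFinset.card = m := by
    rw [← hm, Set.ncard_eq_toFinset_card']; rfl
  have hcount := aux_count_s7 G T d hd hmin' hT.connected hTd'
  rw [hm'] at hcount
  set E := Finset.univ.filter
    (fun φ : Equiv.Perm V => ∀ u v, T.Adj u v → G.Adj (φ u) (φ v)) with hE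
  set Ω := Finset.univ.filter (fun F : SimpleGraph V => T ≤ F ∧ F ≤ G) with hΩ
  have hΩcard : 2 ^ (G.edgeFinset.card - T.edgeFinset.card) ≤ Ω.card := by
    convert aux_interval G T hTG
  have hTcard := hT.card_edgeFinset
  -- every isomorphism between members of the interval is a placement of `T` in `G`
  have hiso : ∀ F ∈ Ω, ∀ F' ∈ Ω, ∀ f : F ≃g F', f.toEquiv ∈ E := by
    intro F hF F' hF' f
    simp only [hΩ, Finset.mem_filter, Finset.mem_univ, true_and] at hF hF'
    simp only [hE, Finset.mem_filter, Finset.mem_univ, true_and]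
    intro u v huv
    exact hF'.2 (f.map_rel_iff.2 (hF.1 huv))
  let st : Setoid (SimpleGraph V) :=
    { r := fun F F' => Nonempty (F ≃g F')
      iseqv := ⟨fun F => ⟨SimpleGraph.Iso.refl⟩, fun ⟨f⟩ => ⟨f.symm⟩,
        fun ⟨f⟩ ⟨g⟩ => ⟨f.trans g⟩⟩ }
  let c : SimpleGraph V → Quotient st := fun F => Quotient.mk st F
  have hfib : Ω.card ≤ E.card * (Ω.image c).card := by
    apply Finset.card_le_mul_card_image
    intro b hb
    obtain ⟨F, hF, rfl⟩ := Finset.mem_image.1 hb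
    calc _ ≤ (E.image (fun φ => F.map φ.toEmbedding)).card := by
          apply Finset.card_le_card
          intro F' hF'
          obtain ⟨hF'Ω, hcF'⟩ := Finset.mem_filter.1 hF'
          obtain ⟨f⟩ : Nonempty (F ≃g F') := Quotient.exact hcF'.symm
          refine Finset.mem_image.2 ⟨f.toEquiv, hiso F hF F' hF'Ω f, ?_⟩
          ext u v
          rw [SimpleGraph.map_adj]
          constructor
          · rintro ⟨a, b, hab, rfl, rfl⟩
            exact f.map_rel_iff.2 hab
          · intro huv
            refine ⟨f.symm u, f.symm v, f.symm.map_rel_iff.2 huv, ?_, ?_⟩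
            · exact f.apply_symm_apply u
            · exact f.apply_symm_apply v
      _ ≤ _ := Finset.card_image_le
  obtain ⟨S, hSΩ, hSinj, hSim⟩ : ∃ S ⊆ Ω, Set.InjOn c S ∧ S.image c = Ω.image c := by
    obtain ⟨S, h1, h2, h3⟩ := Finset.exists_subset_injOn_image_eq_of_surjOn (f := c)
      (s := Ω) (t := Ω.image c) (by intro x hx; simpa using hx)
    exact ⟨S, by exact_mod_cast h1, by assumption, by assumption⟩
  have hScard : S.card = (Ω.image c).card := by
    rw [← hSim, Finset.card_image_of_injOn hSinj]
  refine ⟨S, ?_, ?_, ?_⟩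
  · rw [← hScard] at hfib
    have hnm : n * 500 ≤ m := by
      have h1 := G.sum_degrees_eq_twice_card_edges
      have h2 : n * 1000 ≤ ∑ v, G.degree v := by
        calc n * 1000 = ∑ v : V, 1000 := by simp [hn]
          _ ≤ _ := Finset.sum_le_sum (fun v _ => hd.trans (hmin' v))
      rw [h1, hm'] at h2
      clear hΩcard hfib
      linarith
    have hT' : T.edgeFinset.card ≤ n := by
      rw [← hn, ← hTcard]
      exact Nat.le_succ _
    have hE0 : (0 : ℝ) < 2 ^ ((m : ℝ) / 10) := by positivity
    have h1 : (2 : ℝ) ^ (m - T.edgeFinset.card) ≤ E.card * S.card := by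
      rw [hm'] at hΩcard
      have h0 := hΩcard.trans hfib
      have h0' : ((2 ^ (m - T.edgeFinset.card) : ℕ) : ℝ) ≤ ((E.card * S.card : ℕ) : ℝ) :=
        Nat.cast_le.2 h0
      rwa [Nat.cast_pow, Nat.cast_mul, Nat.cast_ofNat] at h0'
    have h2 : (2 : ℝ) ^ ((m : ℝ) / 10) * 2 ^ (4 * (m : ℝ) / 5) ≤
        2 ^ ((m : ℝ) / 10) * S.card := by
      calc (2 : ℝ) ^ ((m : ℝ) / 10) * 2 ^ (4 * (m : ℝ) / 5)
          = 2 ^ ((m : ℝ) / 10 + 4 * (m : ℝ) / 5) := by rw [Real.rpow_add (by norm_num)]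
        _ ≤ 2 ^ (((m - T.edgeFinset.card : ℕ) : ℝ)) := by
            apply Real.rpow_le_rpow_of_exponent_le (by norm_num)
            rw [Nat.cast_sub (by clear hΩcard hfib; omega)]
            have h3 : (T.edgeFinset.card : ℝ) ≤ n := by exact_mod_cast hT'
            have h4 : (n : ℝ) * 500 ≤ m := by exact_mod_cast hnm
            linarith
        _ = 2 ^ (m - T.edgeFinset.card) := Real.rpow_natCast _ _
        _ ≤ E.card * S.card := h1
        _ ≤ _ := by gcongr
    exact le_of_mul_le_mul_left h2 hE0
  · intro F hF
    have hFΩ := hSΩ hF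
    have hF' : T ≤ F ∧ F ≤ G := by simpa [hΩ] using hFΩ
    refine ⟨hF'.2, hT.connected.mono hF'.1, le_trans ?_ hcount⟩
    have : Nat.card (F ≃g F) ≤ Nat.card E := by
      apply Nat.card_le_card_of_injective (fun f => (⟨f.toEquiv, hiso F hFΩ F hFΩ f⟩ : E))
      intro f g hfg
      simp only [Subtype.mk.injEq] at hfg
      exact RelIso.toEquiv_injective hfg
    rw [Nat.card_eq_fintype_card (α := E), Fintype.card_coe] at this
    exact_mod_cast this
  · intro F hF F' hF' hne
    by_contra h
    rw [not_isEmpty_iff] at h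
    exact hne (hSinj hF hF' (Quotient.sound h))
end
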